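/- arXiv:1107.2102 — 2 statements merged into one kernel-verified Lean document; each statement's English description precedes it below -/
import Mathlib

section
/- Let (R,𝔪) and (S,𝔫) be Noetherian local rings, f : R → S a flat local homomorphism, and M a finitely generated R-module. Then M ⊗_R S is a Cohen–Macaulay S-module if and only if M is a Cohen–Macaulay R-module and the fiber ring S ⊗_R (R/𝔪) is a Cohen–Macaulay ring. -/
noncomputable section
open CategoryTheory

namespace Paper

variable (R : Type) [CommRing R]

/-- The `i`-th local cohomology of the `R`-module `M` with respect to the ideal `I`. -/
abbrev H (I : Ideal R) (i : ℕ) (M : Type) [AddCommGroup M] [Module R M] : ModuleCat R :=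
  (localCohomology I i).obj (ModuleCat.of R M)

/-- `N` is a `p`-secondary submodule of `M`: it is nonzero, every `r : R` acts on it either
surjectively or nilpotently, and `p` is the radical of its annihilator. -/
def IsSecondaryFor {M : Type} [AddCommGroup M] [Module R M]
    (N : Submodule R M) (p : Ideal R) : Prop :=
  N ≠ ⊥ ∧
  (∀ r : R, (∀ m ∈ N, ∃ n ∈ N, r • n = m) ∨ (∃ k : ℕ, ∀ m ∈ N, r ^ k • m = 0)) ∧
  N.annihilator.radical = p

/-- A minimal secondary representation of the module `M`. -/
structure MinSecRep (M : Type) [AddCommGroup M] [Module R M] where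
  n : ℕ
  S : Fin n → Submodule R M
  p : Fin n → Ideal R
  prime : ∀ i, (p i).IsPrime
  sec : ∀ i, IsSecondaryFor R (S i) (p i)
  sum : (⨆ i, S i) = ⊤
  inj : Function.Injective p
  irred : ∀ j, ¬ (S j ≤ ⨆ i ∈ ({j}ᶜ : Set (Fin n)), S i)

/-- `M` is representable: it is a (finite) sum of secondary submodules. -/
def IsRepresentable (M : Type) [AddCommGroup M] [Module R M] : Prop :=
  ∃ (n : ℕ) (S : Fin n → Submodule R M) (p : Fin n → Ideal R),
    (∀ i, (p i).IsPrime) ∧ (∀ i, IsSecondaryFor R (S i) (p i)) ∧ (⨆ i, S i) = ⊤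

/-- The set of attached primes of `M`: the primes occurring in a minimal secondary
representation of `M`. -/
def attached (M : Type) [AddCommGroup M] [Module R M] : Set (Ideal R) :=
  {q | ∃ (rep : MinSecRep R M) (i : Fin rep.n), rep.p i = q}

/-- The coheight (dimension of `R/I`): Krull dimension of the set of primes containing `I`. -/
def coheight (I : Ideal R) : WithBot ℕ∞ :=
  Order.krullDim {p : Ideal R // p.IsPrime ∧ I ≤ p}

/-- The Krull dimension of the ring `R`. -/
def ringDim : WithBot ℕ∞ := Order.krullDim {p : Ideal R // p.IsPrime}

/-- The Krull dimension of (the support of) the finitely generated module `M`. -/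
def dimMod (M : Type) [AddCommGroup M] [Module R M] : WithBot ℕ∞ :=
  coheight R (Module.annihilator R M)

/-- The dimension of the localized module `M_q`: chains of primes in the support of `M`
contained in `q`. -/
def dimModAt (M : Type) [AddCommGroup M] [Module R M] (q : Ideal R) : WithBot ℕ∞ :=
  Order.krullDim {p : Ideal R // p.IsPrime ∧ Module.annihilator R M ≤ p ∧ p ≤ q}

/-- The support of a finitely generated module: primes containing the annihilator. -/
def supp (M : Type) [AddCommGroup M] [Module R M] : Set (Ideal R) :=
  {p | p.IsPrime ∧ Module.annihilator R M ≤ p}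

/-- `Min M`: minimal primes of the support of `M`. -/
def minSupp (M : Type) [AddCommGroup M] [Module R M] : Set (Ideal R) :=
  (Module.annihilator R M).minimalPrimes

/-- `Assh M`: primes in the support of maximal coheight. -/
def assh (M : Type) [AddCommGroup M] [Module R M] : Set (Ideal R) :=
  {p | p ∈ supp R M ∧ coheight R p = dimMod R M}

open RingTheory.Sequence in
/-- Depth of `M` with respect to the ideal `J`: supremum of the lengths of `M`-regular
sequences contained in `J`. -/
def depthOn (J : Ideal R) (M : Type) [AddCommGroup M] [Module R M] : ℕ∞ :=
  ⨆ l ∈ {l : List R | (∀ x ∈ l, x ∈ J) ∧ IsRegular M l}, (l.length : ℕ∞)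

/-- `M` is a Cohen–Macaulay module over the local ring `R`: depth = dimension. -/
def IsCMLocalMod [IsLocalRing R] (M : Type) [AddCommGroup M] [Module R M] : Prop :=
  (depthOn R (IsLocalRing.maximalIdeal R) M : WithBot ℕ∞) = dimMod R M

/-- `R` is a Cohen–Macaulay local ring: it is local and its depth (w.r.t. its Jacobson
radical, which is the maximal ideal) equals its Krull dimension. -/
def IsCMLocalRing : Prop :=
  IsLocalRing R ∧ ((depthOn R ((⊥ : Ideal R).jacobson) R : WithBot ℕ∞) = ringDim R)

/-- `R` is a Cohen–Macaulay ring: all of its localizations at primes are CM local rings. -/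
def IsCMRing : Prop :=
  ∀ (p : Ideal R) [p.IsPrime], IsCMLocalRing (Localization.AtPrime p)

/-- `M` is an equidimensional module: every minimal prime of its support has coheight equal
to the dimension of `M`. -/
def IsEquidim (M : Type) [AddCommGroup M] [Module R M] : Prop :=
  ∀ q ∈ minSupp R M, coheight R q = dimMod R M

/-- `R` is catenary: any two saturated chains of primes with the same endpoints have the
same length. -/
def IsCatenary : Prop :=
  ∀ (c₁ c₂ : LTSeries {p : Ideal R // p.IsPrime}),
    c₁.head = c₂.head → c₁.last = c₂.last →
    (∀ i : Fin c₁.length, c₁.toFun i.castSucc ⋖ c₁.toFun i.succ) →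
    (∀ i : Fin c₂.length, c₂.toFun i.castSucc ⋖ c₂.toFun i.succ) →
    c₁.length = c₂.length

/-- `R` is universally catenary: every finitely generated `R`-algebra is catenary. -/
def IsUnivCatenary : Prop :=
  ∀ (A : Type) [CommRing A] [Algebra R A], Algebra.FiniteType R A → IsCatenary A

/-- `x` is a uniform local cohomological annihilator of `M`: `x` avoids all minimal primes
of `M` and, for every maximal ideal `m`, kills `H^i_m(M)` for all `i < dim M_m`. -/
def IsULCA (M : Type) [AddCommGroup M] [Module R M] (x : R) : Prop :=
  (∀ p ∈ minSupp R M, x ∉ p) ∧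
  ∀ (m : Ideal R), m.IsMaximal → ∀ i : ℕ, (i : WithBot ℕ∞) < dimModAt R M m →
    ∀ y : H R m i M, x • y = 0

/-- `M` has a uniform local cohomological annihilator. -/
def HasULCA (M : Type) [AddCommGroup M] [Module R M] : Prop := ∃ x, IsULCA R M x

/-- `R/p` has a uniform local cohomological annihilator (local case): some `x ∉ p` kills
`H^i_𝔪(R/p)` for all `i < dim R/p`. -/
def HasULCAQuot [IsLocalRing R] (p : Ideal R) : Prop :=
  ∃ x ∉ p, ∀ i : ℕ, (i : WithBot ℕ∞) < coheight R p →
    ∀ y : H R (IsLocalRing.maximalIdeal R) i (R ⧸ p), x • y = 0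

/-- `M` is generalized Cohen–Macaulay over the local ring `R`: a power of the maximal ideal
kills all local cohomology below the dimension. -/
def IsGCM [IsLocalRing R] (M : Type) [AddCommGroup M] [Module R M] : Prop :=
  ∃ n : ℕ, ∀ i : ℕ, (i : WithBot ℕ∞) < dimMod R M →
    ∀ a ∈ (IsLocalRing.maximalIdeal R) ^ n,
      ∀ y : H R (IsLocalRing.maximalIdeal R) i M, a • y = 0

end Paper

open IsLocalRing TensorProduct RingTheory.Sequence
open scoped Pointwise

universe v

section
variable {R : Type*} [CommRing R]

theorem IsSMulRegular.quotSMulTop_map_injective {M N P : Type*} [AddCommGroup M] [Module R M]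
    [AddCommGroup N] [Module R N] [AddCommGroup P] [Module R P] {f : M →ₗ[R] N} {g : N →ₗ[R] P}
    (hf : Function.Injective f)
    (hfg : Function.Exact f g) {x : R} (hx : IsSMulRegular P x) :
    Function.Injective (QuotSMulTop.map x f) := by
  have h0 : Function.Exact (0 : PUnit →ₗ[R] M) f := by
    rwa [LinearMap.exact_zero_iff_injective]
  have := QuotSMulTop.map_first_exact_on_four_term_exact_of_isSMulRegular_last h0 hfg hx
  rwa [map_zero, LinearMap.exact_zero_iff_injective] at this

theorem isWeaklyRegular_of_exact {M N P : Type*} [AddCommGroup M] [Module R M] [AddCommGroup N]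
    [Module R N] [AddCommGroup P] [Module R P] {f : M →ₗ[R] N} {g : N →ₗ[R] P}
    (hf : Function.Injective f) (hfg : Function.Exact f g) (hg : Function.Surjective g)
    {l : List R} (hM : IsWeaklyRegular M l) (hP : IsWeaklyRegular P l) :
    IsWeaklyRegular N l := by
  induction l generalizing M N P with
  | nil => exact .nil R N
  | cons x l ih =>
    rw [isWeaklyRegular_cons_iff] at hM hP ⊢
    exact ⟨isSMulRegular_of_range_eq_ker hf hfg.linearMap_ker_eq.symm hM.1 hP.1,
      ih (hP.1.quotSMulTop_map_injective hf hfg) (QuotSMulTop.map_exact x hfg hg)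
        (QuotSMulTop.map_surjective x hg) hM.2 hP.2⟩

/-- The quotient `(M / y M) / x (M / y M)` is `M / (y M + x M)`. -/
def quotSMulTopQuotSMulTopEquiv (M : Type*) [AddCommGroup M] [Module R M] (x y : R) :
    QuotSMulTop x (QuotSMulTop y M) ≃ₗ[R]
      M ⧸ (y • (⊤ : Submodule R M) ⊔ x • (⊤ : Submodule R M)) :=
  Submodule.quotEquivOfEq _ _ (by
    rw [Submodule.map_pointwise_smul, Submodule.map_top, Submodule.range_mkQ]) ≪≫ₗ
    Submodule.quotientQuotientEquivQuotientSup (y • ⊤) (x • ⊤)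

/-- Dividing out first by `y` and then by `x` is the same as the other way round. -/
def quotSMulTopComm (M : Type*) [AddCommGroup M] [Module R M] (x y : R) :
    QuotSMulTop x (QuotSMulTop y M) ≃ₗ[R] QuotSMulTop y (QuotSMulTop x M) :=
  quotSMulTopQuotSMulTopEquiv M x y ≪≫ₗ Submodule.quotEquivOfEq _ _ (sup_comm _ _) ≪≫ₗ
    (quotSMulTopQuotSMulTopEquiv M y x).symm

/-- `(M / I M) / x` is `(M / x M) / I`. -/
def quotSMulTopQuotEquiv (M : Type*) [AddCommGroup M] [Module R M] (x : R) (I : Ideal R) :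
    QuotSMulTop x (M ⧸ I • (⊤ : Submodule R M)) ≃ₗ[R]
      QuotSMulTop x M ⧸ I • (⊤ : Submodule R (QuotSMulTop x M)) :=
  Submodule.quotEquivOfEq _ _ (by
    rw [Submodule.map_pointwise_smul, Submodule.map_top, Submodule.range_mkQ]) ≪≫ₗ
    Submodule.quotientQuotientEquivQuotientSup (I • ⊤) (x • ⊤) ≪≫ₗ
    Submodule.quotEquivOfEq _ _ (sup_comm _ _) ≪≫ₗ
    (Submodule.quotientQuotientEquivQuotientSup (x • ⊤) (I • ⊤)).symm ≪≫ₗ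
    Submodule.quotEquivOfEq _ _ (by
      rw [Submodule.map_smul'', Submodule.map_top, Submodule.range_mkQ])

theorem isWeaklyRegular_of_subsingleton (M : Type*) [AddCommGroup M] [Module R M] [Subsingleton M]
    (l : List R) : IsWeaklyRegular M l := by
  induction l generalizing M with
  | nil => exact .nil R M
  | cons x l ih => exact .cons (Function.injective_of_subsingleton _) (ih _)

/-- Some nonzero element of `M` is killed by the maximal ideal of `R`. -/
def HasSocle (R : Type*) [CommRing R] [IsLocalRing R] (M : Type*) [AddCommGroup M]
    [Module R M] : Prop :=
  ∃ z : M, z ≠ 0 ∧ ∀ r ∈ maximalIdeal R, r • z = 0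

/-- The list `l` is a maximal `M`-regular sequence in the maximal ideal of `R`. -/
def IsMaxRegular {R : Type*} [CommRing R] [IsLocalRing R] :
    List R → (M : Type v) → [AddCommGroup M] → [Module R M] → Prop
  | [], M, _, _ => HasSocle R M
  | x :: l, M, _, _ => x ∈ maximalIdeal R ∧ IsSMulRegular M x ∧ IsMaxRegular l (QuotSMulTop x M)

variable [IsLocalRing R]

theorem HasSocle.of_injective {M N : Type*} [AddCommGroup M] [Module R M] [AddCommGroup N]
    [Module R N] (h : HasSocle R M) (f : M →ₗ[R] N) (hf : Function.Injective f) :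
    HasSocle R N := by
  obtain ⟨z, hz, h⟩ := h
  exact ⟨f z, by rwa [Ne, map_eq_zero_iff f hf], fun r hr => by rw [← map_smul, h r hr, map_zero]⟩

theorem HasSocle.not_isSMulRegular {M : Type*} [AddCommGroup M] [Module R M] (h : HasSocle R M)
    {x : R} (hx : x ∈ maximalIdeal R) : ¬ IsSMulRegular M x := by
  obtain ⟨z, hz, h⟩ := h
  exact fun hr => hz (hr.right_eq_zero_of_smul (h x hx))

theorem exists_isSMulRegular_of_not_hasSocle [IsNoetherianRing R] {M : Type*} [AddCommGroup M]
    [Module R M] [Module.Finite R M] (h : ¬ HasSocle R M) :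
    ∃ x ∈ maximalIdeal R, IsSMulRegular M x := by
  by_contra! hc
  have hsub : (maximalIdeal R : Set R) ⊆ ⋃ p ∈ associatedPrimes R M, (p : Set R) := by
    intro x hx
    rw [biUnion_associatedPrimes_eq_compl_regular]
    exact hc x hx
  rw [Ideal.subset_union_prime_finite (associatedPrimes.finite R M) 0 0
    (fun p hp _ _ => hp.isPrime)] at hsub
  obtain ⟨p, hp, hle⟩ := hsub
  have hpm : p = maximalIdeal R := le_antisymm (le_maximalIdeal hp.isPrime.ne_top) hle
  rw [AssociatedPrimes.mem_iff, isAssociatedPrime_iff] at hp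
  obtain ⟨hp, z, hz⟩ := hp
  refine h ⟨z, ?_, fun r hr => ?_⟩
  · rintro rfl
    exact hp.ne_top (by ext; simp [hz])
  · simpa [hpm ▸ hz] using hr

/-- Whether `M / x M` has a nonzero socle does not depend on the choice of the `M`-regular
element `x` of the maximal ideal. -/
theorem HasSocle.quotSMulTop_exchange {M : Type*} [AddCommGroup M] [Module R M] {x y : R}
    (hx : IsSMulRegular M x) (hy : IsSMulRegular M y) (hym : y ∈ maximalIdeal R)
    (h : HasSocle R (QuotSMulTop x M)) : HasSocle R (QuotSMulTop y M) := by
  obtain ⟨z, hz, h⟩ := h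
  obtain ⟨z, rfl⟩ := Submodule.Quotient.mk_surjective _ z
  have key (r : R) (hr : r ∈ maximalIdeal R) : ∃ w, x • w = r • z := by
    have := h r hr
    rw [← Submodule.Quotient.mk_smul, Submodule.Quotient.mk_eq_zero,
      Submodule.mem_smul_pointwise_iff_exists] at this
    simpa using this
  obtain ⟨w, hw⟩ := key y hym
  refine ⟨Submodule.Quotient.mk w, fun h0 => hz ?_, fun r hr => ?_⟩
  · rw [Submodule.Quotient.mk_eq_zero, Submodule.mem_smul_pointwise_iff_exists] at h0 ⊢
    obtain ⟨w', -, rfl⟩ := h0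
    exact ⟨w', trivial, hy (by simp only [← hw, smul_comm x y])⟩
  · obtain ⟨u, hu⟩ := key r hr
    rw [← Submodule.Quotient.mk_smul, Submodule.Quotient.mk_eq_zero,
      Submodule.mem_smul_pointwise_iff_exists]
    refine ⟨u, trivial, hx ?_⟩
    simp only
    rw [smul_comm x y, hu, smul_comm x r, hw, smul_comm]

variable {M : Type v} [AddCommGroup M] [Module R M]

theorem IsMaxRegular.mem {l : List R} (h : IsMaxRegular l M) : ∀ x ∈ l, x ∈ maximalIdeal R := by
  induction l generalizing M with
  | nil => simp
  | cons x l ih =>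
    rintro y (_ | ⟨_, hy⟩)
    exacts [h.1, ih h.2.2 y hy]

theorem IsMaxRegular.isRegular {l : List R} (h : IsMaxRegular l M) : IsRegular M l := by
  induction l generalizing M with
  | nil =>
    obtain ⟨z, hz, -⟩ := h
    have := nontrivial_of_ne z 0 hz
    exact .nil R M
  | cons x l ih => exact .cons h.2.1 (ih h.2.2)

theorem IsMaxRegular.of_equiv {N : Type*} [AddCommGroup N] [Module R N] {l : List R}
    (e : M ≃ₗ[R] N) (h : IsMaxRegular l M) : IsMaxRegular l N := by
  induction l generalizing M N with
  | nil => exact HasSocle.of_injective h e.toLinearMap e.injective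
  | cons x l ih =>
    exact ⟨h.1, (e.isSMulRegular_congr x).mp h.2.1, ih (QuotSMulTop.congr x e) h.2.2⟩

theorem length_le_supportDim_of_isRegular [IsNoetherianRing R] [Module.Finite R M]
    {l : List R} (h : IsRegular M l) :
    (l.length : WithBot ℕ∞) ≤ Module.supportDim R M := by
  have := h.quot_ofList_smul_nontrivial ⊤
  have h0 : 0 ≤ Module.supportDim R (M ⧸ Ideal.ofList l • (⊤ : Submodule R M)) :=
    Order.krullDim_nonneg_iff.mpr Module.nonempty_support_of_nontrivial.to_subtype
  rw [← Module.supportDim_add_length_eq_supportDim_of_isRegular l h]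
  exact le_add_of_nonneg_left h0

theorem exists_isMaxRegular [IsNoetherianRing R] [Module.Finite R M] [Nontrivial M] :
    ∃ l : List R, IsMaxRegular l M := by
  have key (n : ℕ) : ∀ (M : Type v) [AddCommGroup M] [Module R M] [Module.Finite R M]
      [Nontrivial M],
      (∃ l : List R, IsMaxRegular l M) ∨ ∃ l : List R, l.length = n ∧ IsRegular M l := by
    induction n with
    | zero => exact fun M _ _ _ _ => .inr ⟨[], rfl, .nil R M⟩
    | succ n ih =>
      intro M _ _ _ _
      by_cases hs : HasSocle R M
      · exact .inl ⟨[], hs⟩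
      obtain ⟨x, hx, hreg⟩ := exists_isSMulRegular_of_not_hasSocle hs
      have := nontrivial_quotSMulTop_of_mem_maximalIdeal M hx
      obtain ⟨l, hl⟩ | ⟨l, rfl, hl⟩ := ih (QuotSMulTop x M)
      · exact .inl ⟨x :: l, hx, hreg, hl⟩
      · exact .inr ⟨x :: l, rfl, .cons hreg hl⟩
  have hlt : Module.supportDim R M < ⊤ :=
    (Module.supportDim_le_ringKrullDim R M).trans_lt ringKrullDim_lt_top
  obtain ⟨d, hd⟩ : ∃ d : ℕ, Module.supportDim R M ≤ d := by
    generalize Module.supportDim R M = a at hlt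
    match a with
    | ⊥ => exact ⟨0, bot_le⟩
    | (⊤ : ℕ∞) => exact absurd hlt (lt_irrefl _)
    | ((n : ℕ) : ℕ∞) => exact ⟨n, le_rfl⟩
  refine (key (d + 1) M).resolve_right ?_
  rintro ⟨l, hl, hreg⟩
  have h1 := (length_le_supportDim_of_isRegular hreg).trans hd
  rw [hl] at h1
  norm_cast at h1
  omega

/-- There is an `M`-regular sequence of length `n` in the maximal ideal of `R`. -/
def HasRegularSequence (R : Type*) [CommRing R] [IsLocalRing R] (M : Type*) [AddCommGroup M]
    [Module R M] (n : ℕ) : Prop :=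
  ∃ l : List R, l.length = n ∧ (∀ x ∈ l, x ∈ maximalIdeal R) ∧ IsRegular M l

theorem hasRegularSequence_succ {n : ℕ} : HasRegularSequence R M (n + 1) ↔
    ∃ x ∈ maximalIdeal R, IsSMulRegular M x ∧ HasRegularSequence R (QuotSMulTop x M) n := by
  constructor
  · rintro ⟨_ | ⟨x, l⟩, hl, hm, hr⟩
    · simp at hl
    · rw [isRegular_cons_iff] at hr
      exact ⟨x, hm x (by simp), hr.1, l, by simpa using hl, fun y hy => hm y (by simp [hy]), hr.2⟩
  · rintro ⟨x, hx, hr, l, rfl, hm, hl⟩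
    exact ⟨x :: l, rfl, by simpa using ⟨hx, hm⟩, .cons hr hl⟩

theorem HasRegularSequence.not_hasSocle {n : ℕ} (h : HasRegularSequence R M (n + 1)) :
    ¬ HasSocle R M := by
  rw [hasRegularSequence_succ] at h
  obtain ⟨x, hx, hr, -⟩ := h
  exact fun hs => hs.not_isSMulRegular hx hr

theorem HasRegularSequence.of_equiv {N : Type*} [AddCommGroup N] [Module R N] {n : ℕ}
    (e : M ≃ₗ[R] N) (h : HasRegularSequence R M n) : HasRegularSequence R N n := by
  obtain ⟨l, hl, hm, hr⟩ := h
  exact ⟨l, hl, hm, (e.isRegular_congr l).mp hr⟩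

theorem IsSMulRegular.quotSMulTop_swap [IsNoetherianRing R] [Module.Finite R M] {x y : R}
    (h1 : IsSMulRegular M x) (hx : x ∈ maximalIdeal R) (hy : y ∈ maximalIdeal R)
    (h2 : IsSMulRegular (QuotSMulTop x M) y) :
    IsSMulRegular (QuotSMulTop y M) x := by
  have h : IsWeaklyRegular M [x, y] := .cons h1 (.cons h2 (.nil _ _))
  have := isWeaklyRegular_of_perm_of_subset_maximalIdeal h (.swap y x [])
    (by simpa using ⟨hx, hy⟩)
  simp only [isWeaklyRegular_cons_iff] at this
  exact this.2.1

theorem HasSocle.of_prod {M N : Type*} [AddCommGroup M] [Module R M] [AddCommGroup N]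
    [Module R N] (h : HasSocle R (M × N)) : HasSocle R M ∨ HasSocle R N := by
  obtain ⟨⟨a, b⟩, hz, h⟩ := h
  by_cases ha : a = 0
  · exact .inr ⟨b, by simpa [ha] using hz, fun r hr => congrArg Prod.snd (h r hr)⟩
  · exact .inl ⟨a, ha, fun r hr => congrArg Prod.fst (h r hr)⟩

theorem HasRegularSequence.quotSMulTop [IsNoetherianRing R] [Module.Finite R M] {n : ℕ}
    (h : HasRegularSequence R M (n + 1))
    {x : R} (hx : x ∈ maximalIdeal R) (hreg : IsSMulRegular M x) :
    HasRegularSequence R (QuotSMulTop x M) n := by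
  induction n generalizing M x with
  | zero =>
    obtain ⟨l, -, -, hr⟩ := h
    have := hr.nontrivial
    have := nontrivial_quotSMulTop_of_mem_maximalIdeal M hx
    exact ⟨[], rfl, by simp, .nil R _⟩
  | succ n ih =>
    obtain ⟨y, hy, hyreg, h'⟩ := hasRegularSequence_succ.mp h
    have hsx : ¬ HasSocle R (QuotSMulTop x M) := fun hs =>
      h'.not_hasSocle (hs.quotSMulTop_exchange hreg hyreg hy)
    have hprod : ¬ HasSocle R (M × QuotSMulTop x M × QuotSMulTop y M) := fun hs => by
      obtain hs | hs := HasSocle.of_prod hs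
      · exact h.not_hasSocle hs
      obtain hs | hs := HasSocle.of_prod hs
      exacts [hsx hs, h'.not_hasSocle hs]
    obtain ⟨w, hw, hwreg⟩ := exists_isSMulRegular_of_not_hasSocle hprod
    have hwM : IsSMulRegular M w := hwreg.of_injective (LinearMap.inl R M _) LinearMap.inl_injective
    have hw' := hwreg.of_injective (LinearMap.inr R M _) LinearMap.inr_injective
    have hwx : IsSMulRegular (QuotSMulTop x M) w :=
      hw'.of_injective (LinearMap.inl R _ _) LinearMap.inl_injective
    have hwy : IsSMulRegular (QuotSMulTop y M) w :=
      hw'.of_injective (LinearMap.inr R _ _) LinearMap.inr_injective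
    have h1 : HasRegularSequence R (QuotSMulTop w M) (n + 1) :=
      hasRegularSequence_succ.mpr ⟨y, hy, hyreg.quotSMulTop_swap hy hw hwy,
        (ih h' hw hwy).of_equiv (quotSMulTopComm M w y)⟩
    exact hasRegularSequence_succ.mpr ⟨w, hw, hwx,
      (ih h1 hx (hreg.quotSMulTop_swap hx hw hwx)).of_equiv (quotSMulTopComm M x w)⟩

/-- No regular sequence is longer than a maximal one. -/
theorem IsMaxRegular.length_le [IsNoetherianRing R] [Module.Finite R M] {l : List R}
    (h : IsMaxRegular l M) {n : ℕ} (hn : HasRegularSequence R M n) : n ≤ l.length := by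
  induction l generalizing M n with
  | nil =>
    cases n with
    | zero => simp
    | succ n => exact absurd h hn.not_hasSocle
  | cons x l ih =>
    cases n with
    | zero => simp
    | succ n => simpa using ih h.2.2 (hn.quotSMulTop h.1 h.2.1)

theorem IsMaxRegular.of_exact {N P : Type*} [AddCommGroup N]
    [Module R N] [AddCommGroup P] [Module R P] {f : M →ₗ[R] N} {g : N →ₗ[R] P}
    (hf : Function.Injective f) (hfg : Function.Exact f g) (hg : Function.Surjective g)
    {l : List R} (hM : IsMaxRegular l M) (hP : IsWeaklyRegular P l) :
    IsMaxRegular l N := by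
  induction l generalizing M N P with
  | nil => exact HasSocle.of_injective hM f hf
  | cons x l ih =>
    rw [isWeaklyRegular_cons_iff] at hP
    exact ⟨hM.1, isSMulRegular_of_range_eq_ker hf hfg.linearMap_ker_eq.symm hM.2.1 hP.1,
      ih (hP.1.quotSMulTop_map_injective hf hfg) (QuotSMulTop.map_exact x hfg hg)
        (QuotSMulTop.map_surjective x hg) hM.2.2 hP.2⟩

theorem isWeaklyRegular_of_forall_quotient_pow [IsNoetherianRing R] {M : Type*} [AddCommGroup M]
    [Module R M] [Module.Finite R M] {I : Ideal R} (hI : I ≠ ⊤) {l : List R}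
    (h : ∀ k : ℕ, IsWeaklyRegular (M ⧸ I ^ k • (⊤ : Submodule R M)) l) :
    IsWeaklyRegular M l := by
  induction l generalizing M with
  | nil => exact .nil R M
  | cons x l ih =>
    simp only [isWeaklyRegular_cons_iff] at h ⊢
    refine ⟨.of_right_eq_zero_of_smul fun z hz => ?_,
      ih fun k => ((quotSMulTopQuotEquiv M x (I ^ k)).isWeaklyRegular_congr l).mp (h k).2⟩
    rw [← Submodule.mem_bot R, ← Ideal.iInf_pow_smul_eq_bot_of_isLocalRing (M := M) I hI,
      Submodule.mem_iInf]
    intro k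
    rw [← Submodule.Quotient.mk_eq_zero]
    refine (h k).1.right_eq_zero_of_smul ?_
    rw [← Submodule.Quotient.mk_smul, hz, Submodule.Quotient.mk_zero]
end

section
variable {R S : Type*} [CommRing R] [CommRing S] [IsLocalRing R] [Algebra R S] [Module.Flat R S]

theorem isWeaklyRegular_tensorProduct_of_pow_smul_eq_zero [IsNoetherianRing R] {M : Type*}
    [AddCommGroup M] [Module R M] [hfin : Module.Finite R M] {l : List S}
    (h : IsWeaklyRegular (S ⊗[R] (R ⧸ maximalIdeal R)) l) {k : ℕ}
    (hk : ∀ r ∈ maximalIdeal R ^ k, ∀ m : M, r • m = 0) : IsWeaklyRegular (S ⊗[R] M) l := by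
  induction hfin using IsNoetherianRing.induction_on_isQuotientEquivQuotientPrime R with
  | subsingleton N => exact isWeaklyRegular_of_subsingleton _ l
  | quotient N p e =>
    have hle : maximalIdeal R ^ k ≤ p.1 := fun r hr => by
      have := hk r hr (e.symm 1)
      rw [← map_smul, map_eq_zero_iff _ e.symm.injective, Algebra.smul_def, mul_one] at this
      exact Ideal.Quotient.eq_zero_iff_mem.mp this
    have hp : p.1 = maximalIdeal R :=
      le_antisymm (le_maximalIdeal p.2.ne_top) (p.2.le_of_pow_le hle)
    rw [← hp] at h
    exact ((e.baseChange R S _ _).isWeaklyRegular_congr l).mpr h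
  | exact N₁ N₂ N₃ f g hf hg hfg h₁ h₃ =>
    refine isWeaklyRegular_of_exact (f := f.baseChange S) (g := g.baseChange S)
      (Module.Flat.lTensor_preserves_injective_linearMap (M := S) f hf) (lTensor_exact S hfg hg)
      (LinearMap.lTensor_surjective S hg) (h₁ fun r hr m => hf ?_) (h₃ fun r hr m => ?_)
    · rw [map_smul, hk r hr, map_zero]
    · obtain ⟨m, rfl⟩ := hg m
      rw [← map_smul, hk r hr, map_zero]

variable [IsLocalRing S] [IsLocalHom (algebraMap R S)] [IsNoetherianRing R] [IsNoetherianRing S]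

theorem isWeaklyRegular_tensorProduct {M : Type*}
    [AddCommGroup M] [Module R M] [Module.Finite R M] {l : List S}
    (h : IsWeaklyRegular (S ⊗[R] (R ⧸ maximalIdeal R)) l) : IsWeaklyRegular (S ⊗[R] M) l := by
  have hI : (maximalIdeal R).map (algebraMap R S) ≠ ⊤ :=
    ne_top_of_le_ne_top (maximalIdeal.isMaximal S).ne_top
      (((local_hom_TFAE (algebraMap R S)).out 0 2).mp ‹_›)
  refine isWeaklyRegular_of_forall_quotient_pow hI fun k => ?_
  rw [← Ideal.map_pow, (tensorQuotMapSMulEquivTensorQuot M S _).isWeaklyRegular_congr]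
  refine isWeaklyRegular_tensorProduct_of_pow_smul_eq_zero h (k := k) fun r hr m => ?_
  obtain ⟨m, rfl⟩ := Submodule.Quotient.mk_surjective _ m
  rw [← Submodule.Quotient.mk_smul, Submodule.Quotient.mk_eq_zero]
  exact Submodule.smul_mem_smul hr trivial

/-- Along a flat local homomorphism, a maximal `M`-regular sequence followed by a maximal regular
sequence of the closed fibre is a maximal regular sequence of the base change of `M`. -/
theorem IsMaxRegular.tensorProduct {M : Type*}
    [AddCommGroup M] [Module R M] [Module.Finite R M] {l : List R} {l' : List S}
    (hM : IsMaxRegular l M) (h : IsMaxRegular l' (S ⊗[R] (R ⧸ maximalIdeal R))) :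
    IsMaxRegular (l.map (algebraMap R S) ++ l') (S ⊗[R] M) := by
  induction l generalizing M with
  | nil =>
    obtain ⟨z, hz, hz'⟩ := hM
    have hk : LinearMap.ker (LinearMap.toSpanSingleton R M z) = maximalIdeal R := by
      refine le_antisymm (le_maximalIdeal fun h => hz ?_) fun r hr => by simpa using hz' r hr
      simpa using (Ideal.eq_top_iff_one _).mp h
    let f := (maximalIdeal R).liftQ (LinearMap.toSpanSingleton R M z) hk.ge
    have hf : Function.Injective f := by
      rw [← LinearMap.ker_eq_bot]
      exact Submodule.ker_liftQ_eq_bot _ _ _ hk.le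
    have hfg : Function.Exact f (LinearMap.range f).mkQ := LinearMap.exact_map_mkQ_range f
    have hg := (LinearMap.range f).mkQ_surjective
    exact h.of_exact (f := f.baseChange S) (g := (LinearMap.range f).mkQ.baseChange S)
      (Module.Flat.lTensor_preserves_injective_linearMap (M := S) f hf) (lTensor_exact S hfg hg)
      (LinearMap.lTensor_surjective S hg) (isWeaklyRegular_tensorProduct h.isRegular.1)
  | cons x l ih =>
    refine ⟨?_, ?_, (ih hM.2.2).of_equiv
      (QuotSMulTop.algebraMapTensorEquivTensorQuotSMulTop x M S).symm⟩
    · have hle : (maximalIdeal R).map (algebraMap R S) ≤ maximalIdeal S :=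
        ((local_hom_TFAE (algebraMap R S)).out 0 2).mp ‹_›
      exact hle (Ideal.mem_map_of_mem _ hM.1)
    · intro a b hab
      exact hM.2.1.lTensor S (by simpa using hab)
end

/-- For a flat local homomorphism, the dimension of the target is the sum of the dimensions of
the source and of the closed fibre. -/
theorem ringKrullDim_eq_add_of_flat (R S : Type*) [CommRing R] [CommRing S] [IsNoetherianRing R]
    [IsNoetherianRing S] [IsLocalRing R] [IsLocalRing S] [Algebra R S] [Module.Flat R S]
    [IsLocalHom (algebraMap R S)] :
    ringKrullDim S = ringKrullDim R +
      ringKrullDim (S ⧸ (maximalIdeal R).map (algebraMap R S)) := by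
  have hle : (maximalIdeal R).map (algebraMap R S) ≤ maximalIdeal S :=
    ((local_hom_TFAE (algebraMap R S)).out 0 2).mp ‹_›
  have : Nontrivial (S ⧸ (maximalIdeal R).map (algebraMap R S)) :=
    Ideal.Quotient.nontrivial_iff.mpr fun h => (maximalIdeal.isMaximal S).ne_top
      (top_le_iff.mp (h ▸ hle))
  have : IsLocalRing (S ⧸ (maximalIdeal R).map (algebraMap R S)) :=
    .of_surjective' (Ideal.Quotient.mk _) Ideal.Quotient.mk_surjective
  have hmap : (maximalIdeal S).map (Ideal.Quotient.mk ((maximalIdeal R).map (algebraMap R S))) =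
      maximalIdeal _ := by
    refine (eq_maximalIdeal ?_)
    exact Ideal.IsMaximal.map_of_surjective_of_ker_le Ideal.Quotient.mk_surjective
      (by rwa [Ideal.mk_ker])
  have h := Ideal.height_eq_height_add_of_liesOver_of_hasGoingDown (maximalIdeal R) (maximalIdeal S)
  rw [hmap] at h
  rw [← maximalIdeal_height_eq_ringKrullDim, ← maximalIdeal_height_eq_ringKrullDim,
    ← maximalIdeal_height_eq_ringKrullDim, h]
  rfl

theorem Module.annihilator_tensorProduct_of_flat (R S M : Type*) [CommRing R] [CommRing S]
    [Algebra R S] [Module.Flat R S] [AddCommGroup M] [Module R M] [Module.Finite R M] :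
    Module.annihilator S (S ⊗[R] M) = (Module.annihilator R M).map (algebraMap R S) := by
  refine le_antisymm (fun s hs => ?_) ?_
  · obtain ⟨n, m, hm⟩ := Module.Finite.exists_fin (R := R) (M := M)
    let φ : R →ₗ[R] Fin n → M := LinearMap.pi fun i => LinearMap.toSpanSingleton R M (m i)
    have hk : LinearMap.ker φ = Module.annihilator R M := by
      ext r
      rw [← Submodule.annihilator_top, ← hm, Submodule.mem_annihilator_span]
      simp [φ, funext_iff]
    let ψ := (Module.annihilator R M).liftQ φ hk.ge
    have hψ : Function.Injective ψ := by
      rw [← LinearMap.ker_eq_bot]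
      exact Submodule.ker_liftQ_eq_bot _ _ _ hk.le
    have hψ' := Module.Flat.lTensor_preserves_injective_linearMap (M := S) ψ hψ
    have h0 : s ⊗ₜ[R] (1 : R ⧸ Module.annihilator R M) = 0 := by
      apply hψ'
      apply (TensorProduct.piRight R R S (fun _ : Fin n => M)).injective
      rw [map_zero, map_zero]
      ext i
      have := Module.mem_annihilator.mp hs ((1:S) ⊗ₜ m i)
      rw [TensorProduct.smul_tmul', smul_eq_mul, mul_one] at this
      have h1 : ψ 1 = m := by
        ext i
        change ((1:R) • m i) = m i
        simp
      simp [h1, this]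
    have := congrArg (Algebra.TensorProduct.quotIdealMapEquivTensorQuot S
      (Module.annihilator R M)).symm h0
    rw [map_zero, ← mul_one s, ← smul_eq_mul, ← TensorProduct.smul_tmul', map_smul] at this
    erw [map_one] at this
    rw [Algebra.smul_def, mul_one] at this
    exact Ideal.Quotient.eq_zero_iff_mem.mp this
  · rw [Ideal.map_le_iff_le_comap]
    intro r hr
    rw [Ideal.mem_comap, Module.mem_annihilator]
    intro x
    induction x with
    | zero => simp
    | add x y hx hy => simp [hx, hy]
    | tmul s m =>
      rw [algebraMap_smul, ← TensorProduct.tmul_smul, Module.mem_annihilator.mp hr,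
        TensorProduct.tmul_zero]

/-- The dimension formula for the base change of a module along a flat local homomorphism. -/
theorem supportDim_tensorProduct_of_flat (R S M : Type*) [CommRing R] [CommRing S]
    [IsNoetherianRing R] [IsNoetherianRing S] [IsLocalRing R] [IsLocalRing S] [Algebra R S]
    [Module.Flat R S] [IsLocalHom (algebraMap R S)] [AddCommGroup M] [Module R M]
    [Module.Finite R M] [Nontrivial M] :
    Module.supportDim S (S ⊗[R] M) = Module.supportDim R M +
      ringKrullDim (S ⧸ (maximalIdeal R).map (algebraMap R S)) := by
  rw [Module.supportDim_eq_ringKrullDim_quotient_annihilator,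
    Module.supportDim_eq_ringKrullDim_quotient_annihilator,
    Module.annihilator_tensorProduct_of_flat]
  set I := Module.annihilator R M
  have hI : I ≠ ⊤ := fun h => not_subsingleton M (Module.annihilator_eq_top_iff.mp h)
  have hle : (maximalIdeal R).map (algebraMap R S) ≤ maximalIdeal S :=
    ((local_hom_TFAE (algebraMap R S)).out 0 2).mp ‹_›
  have hIm : I.map (algebraMap R S) ≤ (maximalIdeal R).map (algebraMap R S) :=
    Ideal.map_mono (le_maximalIdeal hI)
  have : Nontrivial (R ⧸ I) := Ideal.Quotient.nontrivial_iff.mpr hI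
  have : Nontrivial (S ⧸ I.map (algebraMap R S)) := Ideal.Quotient.nontrivial_iff.mpr fun h =>
    (maximalIdeal.isMaximal S).ne_top (top_le_iff.mp (h ▸ hIm.trans hle))
  have : IsLocalRing (R ⧸ I) := .of_surjective' (Ideal.Quotient.mk _) Ideal.Quotient.mk_surjective
  have : IsLocalRing (S ⧸ I.map (algebraMap R S)) :=
    .of_surjective' (Ideal.Quotient.mk _) Ideal.Quotient.mk_surjective
  have : Module.Flat (R ⧸ I) (S ⧸ I.map (algebraMap R S)) :=
    .of_linearEquiv (Algebra.TensorProduct.quotIdealMapEquivQuotTensor S I).toLinearEquiv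
  have hm : (maximalIdeal (R ⧸ I)).map (algebraMap (R ⧸ I) (S ⧸ I.map (algebraMap R S))) =
      ((maximalIdeal R).map (algebraMap R S)).map (Ideal.Quotient.mk _) := by
    rw [← map_maximalIdeal_of_surjective (Ideal.Quotient.mk I) Ideal.Quotient.mk_surjective,
      Ideal.map_map, Ideal.map_map]
    rfl
  have : IsLocalHom (algebraMap (R ⧸ I) (S ⧸ I.map (algebraMap R S))) := by
    refine ((local_hom_TFAE _).out 0 2).mpr ?_
    rw [hm, ← map_maximalIdeal_of_surjective (Ideal.Quotient.mk (I.map (algebraMap R S)))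
      Ideal.Quotient.mk_surjective]
    exact Ideal.map_mono hle
  rw [ringKrullDim_eq_add_of_flat (R ⧸ I), hm,
    ringKrullDim_eq_of_ringEquiv (DoubleQuot.quotQuotEquivQuotOfLE hIm)]

section
variable {R : Type} [CommRing R]

theorem Paper.coheight_eq_ringKrullDim_quotient (I : Ideal R) :
    Paper.coheight R I = ringKrullDim (R ⧸ I) := by
  rw [ringKrullDim_quotient]
  exact Order.krullDim_eq_of_orderIso
    { toFun := fun p => ⟨⟨p.1, p.2.1⟩, p.2.2⟩
      invFun := fun p => ⟨p.1.1, p.1.2, p.2⟩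
      left_inv := fun _ => rfl
      right_inv := fun _ => rfl
      map_rel_iff' := Iff.rfl }

theorem Paper.dimMod_eq_supportDim (M : Type) [AddCommGroup M] [Module R M] [Module.Finite R M] :
    Paper.dimMod R M = Module.supportDim R M := by
  rw [Module.supportDim_eq_ringKrullDim_quotient_annihilator]
  exact Paper.coheight_eq_ringKrullDim_quotient _

theorem Paper.ringDim_eq_ringKrullDim : Paper.ringDim R = ringKrullDim R :=
  Order.krullDim_eq_of_orderIso
    { toFun := fun p => ⟨p.1, p.2⟩
      invFun := fun p => ⟨p.1, p.2⟩
      left_inv := fun _ => rfl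
      right_inv := fun _ => rfl
      map_rel_iff' := Iff.rfl }

variable [IsLocalRing R]

theorem IsMaxRegular.depthOn_eq [IsNoetherianRing R] {M : Type} [AddCommGroup M] [Module R M]
    [Module.Finite R M] {l : List R} (h : IsMaxRegular l M) :
    Paper.depthOn R (maximalIdeal R) M = l.length := by
  refine le_antisymm (iSup₂_le fun l' hl' => ?_) ?_
  · exact_mod_cast h.length_le ⟨l', rfl, hl'.1, hl'.2⟩
  · exact le_iSup₂_of_le (f := fun (l : List R) _ => (l.length : ℕ∞)) l ⟨h.mem, h.isRegular⟩ le_rfl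

theorem Paper.depthOn_le_supportDim [IsNoetherianRing R] (M : Type) [AddCommGroup M] [Module R M]
    [Module.Finite R M] [Nontrivial M] :
    (Paper.depthOn R (maximalIdeal R) M : WithBot ℕ∞) ≤ Module.supportDim R M := by
  obtain ⟨l, hl⟩ := exists_isMaxRegular (R := R) (M := M)
  rw [hl.depthOn_eq]
  exact length_le_supportDim_of_isRegular hl.isRegular

theorem Paper.IsCMLocalMod.nontrivial {M : Type} [AddCommGroup M] [Module R M]
    (h : Paper.IsCMLocalMod R M) : Nontrivial M := by
  by_contra hM
  rw [not_nontrivial_iff_subsingleton] at hM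
  unfold Paper.IsCMLocalMod at h
  rw [Paper.dimMod_eq_supportDim, Module.supportDim_eq_bot_of_subsingleton] at h
  exact WithBot.coe_ne_bot h

theorem Paper.depthOn_eq_of_surjective {S : Type} [CommRing S] [IsLocalRing S] [Algebra R S]
    (hf : Function.Surjective (algebraMap R S)) :
    Paper.depthOn R (maximalIdeal R) S = Paper.depthOn S (maximalIdeal S) S := by
  have hm := map_maximalIdeal_of_surjective _ hf
  have hloc : ∀ x : R, algebraMap R S x ∈ maximalIdeal S ↔ x ∈ maximalIdeal R := by
    intro x
    refine ⟨fun hx hu => hx (hu.map _), fun hx => hm ▸ Ideal.mem_map_of_mem _ hx⟩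
  have hfin : Module.Finite R S := .of_surjective (Algebra.linearMap R S) hf
  refine le_antisymm (iSup₂_le fun l hl => ?_) (iSup₂_le fun l hl => ?_)
  · have hl' : ∀ x ∈ l.map (algebraMap R S), x ∈ maximalIdeal S := by
      simpa only [List.forall_mem_map, hloc] using hl.1
    refine le_iSup₂_of_le (f := fun (l : List S) _ => (l.length : ℕ∞)) (l.map (algebraMap R S))
      ⟨hl', .of_isWeaklyRegular_of_mem_maximalIdeal S hl'
        ((isWeaklyRegular_map_algebraMap_iff S S l).mpr hl.2.1)⟩ (by simp)
  · obtain ⟨l, rfl⟩ := List.map_surjective_iff.mpr hf l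
    have hl' : ∀ x ∈ l, x ∈ maximalIdeal R := by
      simpa only [List.forall_mem_map, hloc] using hl.1
    refine le_iSup₂_of_le (f := fun (l : List R) _ => (l.length : ℕ∞)) l
      ⟨hl', .of_isWeaklyRegular_of_mem_maximalIdeal S hl'
        ((isWeaklyRegular_map_algebraMap_iff S S l).mp hl.2.1)⟩ (by simp)

end

/-- The depth formula for the base change of a module along a flat local homomorphism. -/
theorem depthOn_tensorProduct (R S : Type) [CommRing R] [CommRing S] [IsNoetherianRing R]
    [IsNoetherianRing S] [IsLocalRing R] [IsLocalRing S] [Algebra R S] [Module.Flat R S]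
    [IsLocalHom (algebraMap R S)] (M : Type) [AddCommGroup M] [Module R M] [Module.Finite R M]
    [Nontrivial M] [Nontrivial (S ⊗[R] (R ⧸ maximalIdeal R))] :
    Paper.depthOn S (maximalIdeal S) (S ⊗[R] M) = Paper.depthOn R (maximalIdeal R) M +
      Paper.depthOn S (maximalIdeal S) (S ⊗[R] (R ⧸ maximalIdeal R)) := by
  obtain ⟨l, hl⟩ := exists_isMaxRegular (R := R) (M := M)
  obtain ⟨l', hl'⟩ := exists_isMaxRegular (R := S) (M := S ⊗[R] (R ⧸ maximalIdeal R))
  rw [hl.depthOn_eq, hl'.depthOn_eq, (hl.tensorProduct hl').depthOn_eq]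
  simp

theorem WithBot.coe_eq_and_coe_eq_of_add_eq_add {a b : WithBot ℕ∞} {c d : ℕ∞} (hc : c ≤ a)
    (hd : d ≤ b) (ha : a < ⊤) (hb : b < ⊤) (h : (c : WithBot ℕ∞) + d = a + b) :
    (c : WithBot ℕ∞) = a ∧ (d : WithBot ℕ∞) = b := by
  induction a using WithBot.recBotCoe with
  | bot => exact absurd hc (WithBot.not_coe_le_bot c)
  | coe a =>
  induction b using WithBot.recBotCoe with
  | bot => exact absurd hd (WithBot.not_coe_le_bot d)
  | coe b =>
  have ha' : a ≠ ⊤ := by rintro rfl; exact ha.ne rfl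
  have hb' : b ≠ ⊤ := by rintro rfl; exact hb.ne rfl
  norm_cast at hc hd h ⊢
  lift a to ℕ using ha'
  lift b to ℕ using hb'
  lift c to ℕ using ne_top_of_le_ne_top (ENat.natCast_ne_top a) hc
  lift d to ℕ using ne_top_of_le_ne_top (ENat.natCast_ne_top b) hd
  norm_cast at hc hd h ⊢
  omega

/-- For a flat local homomorphism `R → S` of Noetherian local rings and a finitely
generated `R`-module `M`, the module `M ⊗_R S` is Cohen–Macaulay over `S` iff `M` is
Cohen–Macaulay over `R` and the fibre ring `S ⊗_R R/m` is a Cohen–Macaulay (local)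
ring. -/
theorem tensor_CM_iff (R S : Type) [CommRing R] [CommRing S] [IsNoetherianRing R]
    [IsNoetherianRing S] [IsLocalRing R] [IsLocalRing S] [Algebra R S] [Module.Flat R S]
    (hloc : IsLocalHom (algebraMap R S))
    (M : Type) [AddCommGroup M] [Module R M] [Module.Finite R M] :
    Paper.IsCMLocalMod S (TensorProduct R S M) ↔
      (Paper.IsCMLocalMod R M ∧
        Paper.IsCMLocalRing (TensorProduct R S (R ⧸ IsLocalRing.maximalIdeal R))) := by
  cases subsingleton_or_nontrivial M with
  | inl hM =>
    refine iff_of_false (fun h => ?_) fun h => ?_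
    · have := h.nontrivial
      exact not_subsingleton (S ⊗[R] M) inferInstance
    · have := h.1.nontrivial
      exact not_subsingleton M hM
  | inr hM =>
    let F := S ⊗[R] (R ⧸ maximalIdeal R)
    let e := Algebra.TensorProduct.quotIdealMapEquivTensorQuot S (maximalIdeal R)
    have hle : (maximalIdeal R).map (algebraMap R S) ≤ maximalIdeal S :=
      ((local_hom_TFAE (algebraMap R S)).out 0 2).mp hloc
    have : Nontrivial (S ⧸ (maximalIdeal R).map (algebraMap R S)) :=
      Ideal.Quotient.nontrivial_iff.mpr
        (ne_top_of_le_ne_top (maximalIdeal.isMaximal S).ne_top hle)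
    have : Nontrivial F := e.symm.toEquiv.nontrivial
    have hsurj : Function.Surjective (algebraMap S F) := fun x => by
      obtain ⟨s, hs⟩ := Ideal.Quotient.mk_surjective (e.symm x)
      exact ⟨s, by rw [← e.apply_symm_apply x, ← hs]; exact (e.commutes s).symm⟩
    have : IsLocalRing F := .of_surjective' (algebraMap S F) hsurj
    have : IsNoetherianRing F := isNoetherianRing_of_surjective S F (algebraMap S F) hsurj
    have hdim := supportDim_tensorProduct_of_flat R S M
    rw [ringKrullDim_eq_of_ringEquiv e.toRingEquiv] at hdim
    have hdepth := depthOn_tensorProduct R S M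
    have hM_le := Paper.depthOn_le_supportDim (R := R) M
    have hF_le := Paper.depthOn_le_supportDim (R := F) F
    rw [Module.supportDim_self_eq_ringKrullDim] at hF_le
    replace hdepth := hdepth.trans
      (congrArg (Paper.depthOn R (maximalIdeal R) M + ·) (Paper.depthOn_eq_of_surjective hsurj))
    have hM_top : Module.supportDim R M < ⊤ :=
      (Module.supportDim_le_ringKrullDim R M).trans_lt ringKrullDim_lt_top
    have hF_top : ringKrullDim F < ⊤ := ringKrullDim_lt_top
    unfold Paper.IsCMLocalMod Paper.IsCMLocalRing
    rw [Paper.dimMod_eq_supportDim, Paper.dimMod_eq_supportDim, Paper.ringDim_eq_ringKrullDim,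
      hdim, hdepth, jacobson_eq_maximalIdeal ⊥ bot_ne_top, and_iff_right ‹IsLocalRing F›,
      WithBot.coe_add]
    refine ⟨fun h => ?_, fun h => by rw [h.1, h.2]⟩
    exact WithBot.coe_eq_and_coe_eq_of_add_eq_add hM_le hF_le hM_top hF_top h
end
end

section
/- Let (R,𝔪) be a Noetherian local ring whose formal fibres are all Cohen–Macaulay, M a finitely generated R-module, 𝔓 ∈ Supp(M̂) a prime of the completion, and 𝔭 = 𝔓 ∩ R. Then M_𝔭 is Cohen–Macaulay over R_𝔭 if and only if (M̂)_𝔓 is Cohen–Macaulay over (R̂)_𝔓. -/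
noncomputable section
open CategoryTheory

/-- Multivariate power series in finitely many variables over a Noetherian ring form a
Noetherian ring. -/
theorem MvPowerSeries.isNoetherianRing_fin (R : Type*) [CommRing R] [IsNoetherianRing R] (n : ℕ) :
    IsNoetherianRing (MvPowerSeries (Fin n) R) := by
  induction n with
  | zero =>
    exact isNoetherianRing_of_ringEquiv R (MvPowerSeries.isEmptyEquiv (Fin 0) R).symm.toRingEquiv
  | succ n ih =>
    exact isNoetherianRing_of_ringEquiv _ (MvPowerSeries.finSuccEquiv R n).symm.toRingEquiv

/-- If `A` is adically complete with respect to a finitely generated ideal `J` and a Noetherian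
ring `R` maps onto `A ⧸ J`, then `A` is Noetherian. -/
theorem IsAdicComplete.isNoetherianRing {R A : Type*} [CommRing R] [IsNoetherianRing R]
    [CommRing A] [Algebra R A] (J : Ideal A) [IsAdicComplete J A] (hJ : J.FG)
    (h : Function.Surjective ((Ideal.Quotient.mk J).comp (algebraMap R A))) :
    IsNoetherianRing A := by
  obtain ⟨n, a, ha⟩ := Submodule.fg_iff_exists_fin_generating_family.mp hJ
  let S := MvPolynomial (Fin n) R
  let I : Ideal S := MvPolynomial.idealOfVars (Fin n) R
  let φ : S →+* A := (MvPolynomial.aeval a : S →ₐ[R] A).toRingHom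
  have hI : I.map φ = J := by
    rw [← ha]
    simp only [I, φ, MvPolynomial.idealOfVars, Ideal.map_span, ← Set.range_comp]
    change Ideal.span _ = Ideal.span _
    congr 2
    ext i
    exact MvPolynomial.aeval_X a i
  have hle (k : ℕ) : I ^ k ≤ (J ^ k).comap φ := by
    rw [← Ideal.map_le_iff_le_comap, Ideal.map_pow, hI]
  let f (k : ℕ) : AdicCompletion I S →+* A ⧸ J ^ k :=
    (Ideal.quotientMap (J ^ k) φ (hle k)).comp (AdicCompletion.evalₐ I k).toRingHom
  have hf {k l : ℕ} (hkl : k ≤ l) : (Ideal.Quotient.factorPow J hkl).comp (f l) = f k := by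
    refine RingHom.ext fun x ↦ ?_
    induction x using AdicCompletion.induction_on with | _ c
    have hc : c k - c l ∈ I ^ k := by
      simpa [SModEq.sub_mem] using c.2 hkl
    simp only [f, RingHom.comp_apply, AlgHom.toRingHom_eq_coe, RingHom.coe_coe,
      AdicCompletion.evalₐ_mk, Ideal.quotientMap_mk]
    change Ideal.Quotient.mk (J ^ k) (φ (c l)) = _
    rw [eq_comm, Ideal.Quotient.eq, ← map_sub]
    exact hle k hc
  let F : AdicCompletion I S →+* A := IsAdicComplete.liftRingHom J f hf
  have hF (s : S) : F (algebraMap S _ s) = φ s := by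
    refine (IsHausdorff.eq_iff_smodEq (I := J)).mpr fun k ↦ ?_
    rw [SModEq.sub_mem, smul_eq_mul, Ideal.mul_top, ← Ideal.Quotient.eq,
      IsAdicComplete.mk_liftRingHom]
    simp [f]
  have hIfg : I.FG := IsNoetherian.noetherian I
  have hmap : (I.map (algebraMap S (AdicCompletion I S))).map F = J := by
    rw [Ideal.map_map, ← hI]
    congr 1
    exact RingHom.ext fun s ↦ by simp [hF]
  have := AdicCompletion.isAdicComplete_self I hIfg
  have : IsHausdorff ((I.map (algebraMap S (AdicCompletion I S))).map F) A := by
    rw [hmap]; infer_instance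
  have hsurj : Function.Surjective F := by
    refine surjective_of_mk_map_comp_surjective
      (I := I.map (algebraMap S (AdicCompletion I S))) F ?_
    rw [hmap]
    intro y
    obtain ⟨r, hr⟩ := h y
    refine ⟨algebraMap S _ (MvPolynomial.C r), ?_⟩
    rw [← hr, RingHom.comp_apply, RingHom.comp_apply, hF]
    exact congrArg _ (MvPolynomial.aeval_C a r)
  have := MvPowerSeries.isNoetherianRing_fin R n
  have : IsNoetherianRing (AdicCompletion I S) :=
    isNoetherianRing_of_ringEquiv _
      (MvPowerSeries.toAdicCompletionAlgEquiv (Fin n) R).toRingEquiv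
  exact isNoetherianRing_of_surjective _ _ F hsurj

theorem AdicCompletion.isNoetherianRing {R : Type*} [CommRing R] [IsNoetherianRing R]
    (I : Ideal R) : IsNoetherianRing (AdicCompletion I R) := by
  have hI : I.FG := IsNoetherian.noetherian I
  have := AdicCompletion.isAdicComplete_self I hI
  refine IsAdicComplete.isNoetherianRing (R := R)
    (I.map (algebraMap R (AdicCompletion I R))) (hI.map _) ?_
  intro y
  obtain ⟨y, rfl⟩ := Ideal.Quotient.mk_surjective y
  obtain ⟨r, hr⟩ := Ideal.Quotient.mk_surjective (AdicCompletion.evalOneₐ I y)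
  refine ⟨r, ?_⟩
  rw [RingHom.comp_apply, Ideal.Quotient.eq, ← AdicCompletion.ker_evalOneₐ_eq_map I hI,
    RingHom.mem_ker]
  simp [hr]

namespace Paper

open RingTheory.Sequence IsLocalRing

/-- The local ring `A` has an `N`-regular sequence of length `n` inside its maximal ideal. -/
def HasRegularSeq (A : Type*) [CommRing A] [IsLocalRing A] (N : Type*) [AddCommGroup N]
    [Module A N] (n : ℕ) : Prop :=
  ∃ rs : List A, (∀ r ∈ rs, r ∈ maximalIdeal A) ∧ IsRegular N rs ∧ rs.length = n

theorem dimMod_eq_supportDim_s15 (A : Type) [CommRing A] (N : Type) [AddCommGroup N] [Module A N]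
    [Module.Finite A N] : dimMod A N = Module.supportDim A N := by
  unfold dimMod coheight Module.supportDim
  rw [Module.support_eq_zeroLocus]
  refine Order.krullDim_eq_of_orderIso
    { toFun := fun p => ⟨⟨p.1, p.2.1⟩, p.2.2⟩
      invFun := fun p => ⟨p.1.asIdeal, p.1.isPrime, p.2⟩
      left_inv := fun _ => rfl
      right_inv := fun _ => rfl
      map_rel_iff' := Iff.rfl }

theorem ringDim_eq_ringKrullDim_s15 (A : Type) [CommRing A] : ringDim A = ringKrullDim A :=
  Order.krullDim_eq_of_orderIso
    { toFun := fun p => ⟨p.1, p.2⟩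
      invFun := fun p => ⟨p.asIdeal, p.isPrime⟩
      left_inv := fun _ => rfl
      right_inv := fun _ => rfl
      map_rel_iff' := Iff.rfl }

theorem length_le_supportDim {A : Type*} [CommRing A] [IsNoetherianRing A] [IsLocalRing A]
    {N : Type*} [AddCommGroup N] [Module A N] [Module.Finite A N] {n : ℕ}
    (h : HasRegularSeq A N n) : (n : WithBot ℕ∞) ≤ Module.supportDim A N := by
  obtain ⟨rs, -, hreg, rfl⟩ := h
  have : Nontrivial N := hreg.nontrivial
  have e := Module.supportDim_add_length_eq_supportDim_of_isRegular rs hreg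
  rw [← e]
  have h0 : 0 ≤ Module.supportDim A (N ⧸ Ideal.ofList rs • (⊤ : Submodule A N)) := by
    have : Nontrivial (N ⧸ Ideal.ofList rs • (⊤ : Submodule A N)) :=
      Submodule.Quotient.nontrivial_iff.mpr hreg.top_ne_smul.symm
    exact Order.krullDim_nonneg_iff.mpr (Module.nonempty_support_iff.mpr this).to_subtype
  exact le_add_of_nonneg_left h0

theorem exists_nat_eq_supportDim (A : Type*) [CommRing A] [IsNoetherianRing A] [IsLocalRing A]
    (N : Type*) [AddCommGroup N] [Module A N] [Nontrivial N] :
    ∃ d : ℕ, Module.supportDim A N = d := by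
  have h0 : Module.supportDim A N ≠ ⊥ := Module.supportDim_ne_bot_of_nontrivial A N
  have h1 : Module.supportDim A N < ⊤ :=
    (Module.supportDim_le_ringKrullDim A N).trans_lt ringKrullDim_lt_top
  obtain ⟨a, ha⟩ := WithBot.ne_bot_iff_exists.mp h0
  rw [← ha] at h1 ⊢
  have h2 : a ≠ ⊤ := by
    rintro rfl
    exact absurd h1 (lt_irrefl _)
  obtain ⟨d, rfl⟩ := ENat.ne_top_iff_exists.mp h2
  exact ⟨d, rfl⟩

theorem depthOn_eq_iff {A : Type} [CommRing A] [IsNoetherianRing A] [IsLocalRing A]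
    {N : Type} [AddCommGroup N] [Module A N] [Module.Finite A N] {d : ℕ}
    (hd : Module.supportDim A N = d) :
    (depthOn A (maximalIdeal A) N : WithBot ℕ∞) = d ↔ HasRegularSeq A N d := by
  have hN : Nontrivial N := by
    by_contra h
    rw [not_nontrivial_iff_subsingleton] at h
    rw [Module.supportDim_eq_bot_of_subsingleton] at hd
    exact absurd hd (by simp)
  have hle : depthOn A (maximalIdeal A) N ≤ (d : ℕ∞) := by
    refine iSup₂_le fun l hl => ?_
    have := length_le_supportDim ⟨l, hl.1, hl.2, rfl⟩
    rw [hd] at this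
    exact_mod_cast this
  constructor
  · intro h
    have h' : depthOn A (maximalIdeal A) N = (d : ℕ∞) := by exact_mod_cast h
    rcases Nat.eq_zero_or_pos d with rfl | hpos
    · exact ⟨[], by simp, IsRegular.nil A N, rfl⟩
    · have hlt : ((d - 1 : ℕ) : ℕ∞) < depthOn A (maximalIdeal A) N := by
        rw [h']
        exact_mod_cast Nat.sub_lt hpos one_pos
      obtain ⟨l, hl⟩ := lt_iSup_iff.mp hlt
      obtain ⟨hm, hlen⟩ := lt_iSup_iff.mp hl
      have h1 : d - 1 < l.length := by exact_mod_cast hlen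
      have h2 : (l.length : ℕ∞) ≤ depthOn A (maximalIdeal A) N :=
        le_iSup₂_of_le l hm le_rfl
      rw [h'] at h2
      have h3 : l.length ≤ d := by exact_mod_cast h2
      exact ⟨l, hm.1, hm.2, by omega⟩
  · rintro ⟨l, hm, hreg, rfl⟩
    have h2 : (l.length : ℕ∞) ≤ depthOn A (maximalIdeal A) N :=
      le_iSup₂_of_le l ⟨hm, hreg⟩ le_rfl
    exact_mod_cast le_antisymm hle h2

theorem isCMLocalMod_iff {A : Type} [CommRing A] [IsNoetherianRing A] [IsLocalRing A]
    {N : Type} [AddCommGroup N] [Module A N] [Module.Finite A N] {d : ℕ}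
    (hd : Module.supportDim A N = d) : IsCMLocalMod A N ↔ HasRegularSeq A N d := by
  rw [IsCMLocalMod, dimMod_eq_supportDim_s15, hd, depthOn_eq_iff hd]

theorem IsCMLocalRing.hasRegularSeq {F : Type} [CommRing F] [IsNoetherianRing F] [IsLocalRing F]
    (h : IsCMLocalRing F) {d : ℕ} (hd : ringKrullDim F = d) : HasRegularSeq F F d := by
  have h2 := h.2
  rw [IsLocalRing.jacobson_eq_maximalIdeal ⊥ bot_ne_top, ringDim_eq_ringKrullDim_s15, hd] at h2
  rwa [← depthOn_eq_iff ((Module.supportDim_self_eq_ringKrullDim F).trans hd)]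


open Pointwise in
theorem HasRegularSeq.quotSMulTop {A N : Type} [CommRing A] [IsNoetherianRing A] [IsLocalRing A]
    [AddCommGroup N] [Module A N] [Module.Finite A N] {n : ℕ} (h : HasRegularSeq A N (n + 1))
    {x : A} (hx : x ∈ maximalIdeal A) (hreg : IsSMulRegular N x) :
    HasRegularSeq A (QuotSMulTop x N) n := by
  obtain ⟨rs, mem, reg, len⟩ := h
  have hN : Nontrivial N := reg.nontrivial
  have smul_lt {Q : Type} [AddCommGroup Q] [Module A Q] [Module.Finite A Q] [Nontrivial Q] :
      maximalIdeal A • (⊤ : Submodule A Q) < ⊤ :=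
    (Submodule.top_ne_ideal_smul_of_le_jacobson_annihilator
      (IsLocalRing.maximalIdeal_le_jacobson _)).symm.lt_top
  let K : ModuleCat.{0} A := ModuleCat.of A (A ⧸ maximalIdeal A)
  have hK : Module.support A K = PrimeSpectrum.zeroLocus (maximalIdeal A) := by
    change Module.support A (A ⧸ maximalIdeal A) = _
    rw [Module.support_eq_zeroLocus, Ideal.annihilator_quotient]
  have hfinK : Module.Finite A K := inferInstanceAs (Module.Finite A (A ⧸ maximalIdeal A))
  have hfinN : Module.Finite A (ModuleCat.of A N) := inferInstanceAs (Module.Finite A N)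
  have hext := ModuleCat.subsingleton_ext_of_exists_isRegular (maximalIdeal A) K hK.le
    (ModuleCat.of A N) smul_lt rs mem reg
  have hntr : Nontrivial (QuotSMulTop x N) :=
    nontrivial_quotSMulTop_of_mem_maximalIdeal N hx
  have hext' : ∀ i < n,
      Subsingleton (Abelian.Ext K (ModuleCat.of A (QuotSMulTop x N)) i) := by
    intro i hi
    have zero1 := AddCommGrpCat.isZero_of_iff_subsingleton.mpr (hext i (by omega))
    have zero2 := AddCommGrpCat.isZero_of_iff_subsingleton.mpr (hext (i + 1) (by omega))
    exact AddCommGrpCat.subsingleton_of_isZero <| ShortComplex.Exact.isZero_of_both_zeros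
      ((Abelian.Ext.covariant_sequence_exact₃' K
        (IsSMulRegular.smulShortComplex_shortExact (M := ModuleCat.of A N) hreg)) i (i + 1) rfl)
      (zero1.eq_zero_of_src _) (zero2.eq_zero_of_tgt _)
  have hfinQ : Module.Finite A (ModuleCat.of A (QuotSMulTop x N)) :=
    inferInstanceAs (Module.Finite A (QuotSMulTop x N))
  obtain ⟨l, hlen, hmem, hl⟩ := ModuleCat.exists_isRegular_of_exists_subsingleton_ext
    (maximalIdeal A) n (ModuleCat.of A (QuotSMulTop x N)) smul_lt K hK hext'
  exact ⟨l, hmem, hl, hlen⟩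

open Pointwise in
/-- A nonzero submodule of a module with a regular sequence of length `n` has dimension at
least `n`. -/
theorem HasRegularSeq.le_supportDim_submodule {B : Type*} [CommRing B] [IsNoetherianRing B]
    [IsLocalRing B] {n : ℕ} {Q : Type*} [AddCommGroup Q] [Module B Q] [Module.Finite B Q]
    (h : HasRegularSeq B Q n) (U : Submodule B Q) (hU : U ≠ ⊥) :
    (n : WithBot ℕ∞) ≤ Module.supportDim B U := by
  induction n generalizing Q with
  | zero =>
    have : Nontrivial U := Submodule.nontrivial_iff_ne_bot.mpr hU
    exact Order.krullDim_nonneg_iff.mpr (Module.nonempty_support_iff.mpr this).to_subtype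
  | succ n ih =>
    obtain ⟨rs, mem, reg, len⟩ := h
    match rs with
    | [] => simp at len
    | x :: l =>
      rw [isRegular_cons_iff] at reg
      have hx : x ∈ maximalIdeal B := mem x List.mem_cons_self
      have hl : HasRegularSeq B (QuotSMulTop x Q) n :=
        ⟨l, fun r hr => mem r (List.mem_cons_of_mem _ hr), reg.2, by simpa using len⟩
      let f : ℕ →o Submodule B Q :=
        { toFun := fun k => U.comap (LinearMap.lsmul B Q (x ^ k))
          monotone' := by
            intro a b hab q hq
            simp only [Submodule.mem_comap, LinearMap.lsmul_apply] at hq ⊢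
            obtain ⟨c, rfl⟩ := Nat.exists_eq_add_of_le hab
            rw [add_comm, pow_add, mul_smul]
            exact U.smul_mem _ hq }
      obtain ⟨K, hK⟩ := monotone_stabilizes_iff_noetherian.mpr
        (inferInstance : IsNoetherian B Q) f
      let U' : Submodule B Q := f K
      have hUU' : U ≤ U' := fun q hq => U.smul_mem _ hq
      have hsat : ∀ q, x • q ∈ U' → q ∈ U' := by
        intro q hq
        have : q ∈ f (K + 1) := by
          change x ^ (K + 1) • q ∈ U
          rw [pow_succ, mul_smul]
          exact hq
        rwa [← hK (K + 1) (Nat.le_succ K)] at this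
      let g : U' →ₗ[B] U :=
        ((LinearMap.lsmul B Q (x ^ K)).comp U'.subtype).codRestrict U (fun q => q.2)
      have hg : Function.Injective g := by
        intro a b hab
        exact Subtype.ext (reg.1.pow K (congrArg Subtype.val hab))
      have hdim := Module.supportDim_le_of_injective g hg
      have hregU : IsSMulRegular U' x := fun a b hab =>
        Subtype.ext (reg.1 (congrArg Subtype.val hab))
      have hdim' := Module.supportDim_quotSMulTop_succ_eq_supportDim hregU hx
      have hle : x • (⊤ : Submodule B U') ≤ (x • (⊤ : Submodule B Q)).comap U'.subtype := by
        rintro _ ⟨u, -, rfl⟩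
        exact ⟨u.1, trivial, rfl⟩
      let φ : QuotSMulTop x U' →ₗ[B] QuotSMulTop x Q := Submodule.mapQ _ _ U'.subtype hle
      have hφ : Function.Injective φ := by
        rw [← LinearMap.ker_eq_bot, Submodule.ker_mapQ, eq_bot_iff, Submodule.map_le_iff_le_comap]
        rintro ⟨u, hu⟩ ⟨q, -, hq⟩
        refine (Submodule.Quotient.mk_eq_zero _).mpr ?_
        have hq' : x • q = u := hq
        have : q ∈ U' := hsat q (by rwa [hq'])
        exact ⟨⟨q, this⟩, trivial, Subtype.ext hq'⟩
      have hU' : Nontrivial U' := Submodule.nontrivial_iff_ne_bot.mpr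
        fun h => hU (le_bot_iff.mp (h ▸ hUU'))
      have hntr : Nontrivial (QuotSMulTop x U') :=
        nontrivial_quotSMulTop_of_mem_maximalIdeal U' hx
      have hran : LinearMap.range φ ≠ ⊥ := by
        intro h0
        rw [LinearMap.range_eq_bot] at h0
        obtain ⟨a, b, hab⟩ := exists_pair_ne (QuotSMulTop x U')
        exact hab (hφ (by rw [h0]; rfl))
      have key := ih hl (LinearMap.range φ) hran
      rw [← Module.supportDim_eq_of_equiv (LinearEquiv.ofInjective φ hφ)] at key
      refine le_trans ?_ hdim
      rw [← hdim']
      push_cast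
      gcongr


section Tensor

open TensorProduct Pointwise

variable {A B : Type*} [CommRing A] [CommRing B] [Algebra A B]
  (G : Type*) [AddCommGroup G] [Module A G] [Module B G] [IsScalarTower A B G]
  (L : Type*) [AddCommGroup L] [Module A L]

theorem finite_tensorProduct [Module.Finite B G] [Module.Finite A L] :
    Module.Finite B (G ⊗[A] L) := by
  obtain ⟨n, f, hf⟩ := Module.Finite.exists_fin' A L
  let e : G ⊗[A] (Fin n → A) ≃ₗ[B] (Fin n → G) :=
    (piRight A B G fun _ : Fin n => A).trans
      (LinearEquiv.piCongrRight fun _ => AlgebraTensorModule.rid A B G)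
  refine Module.Finite.of_surjective
    ((AlgebraTensorModule.lTensor B G f).comp e.symm.toLinearMap) ?_
  rw [LinearMap.coe_comp]
  refine Function.Surjective.comp ?_ e.symm.surjective
  rw [AlgebraTensorModule.coe_lTensor]
  exact LinearMap.lTensor_surjective G hf

variable {G} in
theorem mem_ker_rTensor_iff {Q : Type*} [AddCommGroup Q] [Module A Q] [Module B Q]
    [IsScalarTower A B Q] {π : G →ₗ[B] Q} (hπ : Function.Surjective π) {b : B}
    (hk : LinearMap.ker π = b • (⊤ : Submodule B G)) (t : G ⊗[A] L) :
    AlgebraTensorModule.rTensor A L π t = 0 ↔ ∃ s, b • s = t := by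
  have hex : Function.Exact ((LinearMap.lsmul B G b).restrictScalars A)
      (π.restrictScalars A) := by
    intro g
    change π g = 0 ↔ _
    rw [← LinearMap.mem_ker, hk]
    constructor
    · rintro ⟨g', -, rfl⟩
      exact ⟨g', rfl⟩
    · rintro ⟨g', rfl⟩
      exact ⟨g', trivial, rfl⟩
  have hex' := rTensor_exact L hex hπ
  have hsmul : ∀ t : G ⊗[A] L,
      LinearMap.rTensor L ((LinearMap.lsmul B G b).restrictScalars A) t = b • t := by
    intro t
    induction t with
    | zero => simp
    | tmul g l => rfl
    | add s t hs ht => rw [map_add, hs, ht, smul_add]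
  rw [AlgebraTensorModule.coe_rTensor]
  refine (hex' t).trans ⟨?_, ?_⟩
  · rintro ⟨s, rfl⟩
    exact ⟨s, (hsmul s).symm⟩
  · rintro ⟨s, rfl⟩
    exact ⟨s, hsmul s⟩

variable {G} in
theorem rTensor_surjective {Q : Type*} [AddCommGroup Q] [Module A Q] [Module B Q]
    [IsScalarTower A B Q] {π : G →ₗ[B] Q} (hπ : Function.Surjective π) :
    Function.Surjective (AlgebraTensorModule.rTensor A L π) := by
  rw [AlgebraTensorModule.coe_rTensor]
  exact LinearMap.rTensor_surjective L hπ

variable {G} in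
/-- `(G ⊗ L) / b (G ⊗ L) ≃ Q ⊗ L` when `Q = G / b G`. -/
def quotSMulTopTensorEquiv {Q : Type*} [AddCommGroup Q] [Module A Q] [Module B Q]
    [IsScalarTower A B Q] {π : G →ₗ[B] Q} (hπ : Function.Surjective π) {b : B}
    (hk : LinearMap.ker π = b • (⊤ : Submodule B G)) :
    QuotSMulTop b (G ⊗[A] L) ≃ₗ[B] Q ⊗[A] L :=
  (Submodule.quotEquivOfEq _ (LinearMap.ker (AlgebraTensorModule.rTensor A L π)) <| by
      ext t
      rw [LinearMap.mem_ker, mem_ker_rTensor_iff L hπ hk]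
      exact ⟨fun ⟨s, _, hs⟩ => ⟨s, hs⟩, fun ⟨s, hs⟩ => ⟨s, trivial, hs⟩⟩).trans
    (LinearMap.quotKerEquivOfSurjective _ (rTensor_surjective L hπ))

theorem ker_lTensor_mkQ_smul_top (x : A) :
    LinearMap.ker (AlgebraTensorModule.lTensor B G (x • (⊤ : Submodule A L)).mkQ) =
      algebraMap A B x • (⊤ : Submodule B (G ⊗[A] L)) := by
  have hex : Function.Exact (LinearMap.lsmul A L x) (x • (⊤ : Submodule A L)).mkQ := by
    intro g
    refine (Submodule.Quotient.mk_eq_zero _).trans ⟨?_, ?_⟩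
    · rintro ⟨g', -, rfl⟩
      exact ⟨g', rfl⟩
    · rintro ⟨g', rfl⟩
      exact ⟨g', trivial, rfl⟩
  have hex' := lTensor_exact G hex (Submodule.mkQ_surjective _)
  have hsmul : ∀ t : G ⊗[A] L,
      LinearMap.lTensor G (LinearMap.lsmul A L x) t = algebraMap A B x • t := by
    intro t
    induction t with
    | zero => simp
    | tmul g l =>
      rw [LinearMap.lTensor_tmul, smul_tmul', algebraMap_smul, LinearMap.lsmul_apply,
        ← smul_tmul]
    | add s t hs ht => rw [map_add, hs, ht, smul_add]
  ext t
  rw [LinearMap.mem_ker, AlgebraTensorModule.coe_lTensor]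
  refine (hex' t).trans ⟨?_, ?_⟩
  · rintro ⟨s, rfl⟩
    exact ⟨s, trivial, (hsmul s).symm⟩
  · rintro ⟨s, -, rfl⟩
    exact ⟨s, hsmul s⟩

/-- `(G ⊗ L) / x (G ⊗ L) ≃ G ⊗ (L / x L)`. -/
def quotSMulTopTensorEquiv' (x : A) :
    QuotSMulTop (algebraMap A B x) (G ⊗[A] L) ≃ₗ[B] G ⊗[A] QuotSMulTop x L :=
  (Submodule.quotEquivOfEq _ _ (ker_lTensor_mkQ_smul_top G L x).symm).trans
    (LinearMap.quotKerEquivOfSurjective _ <| by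
      rw [AlgebraTensorModule.coe_lTensor]
      exact LinearMap.lTensor_surjective G (Submodule.mkQ_surjective _))

variable {G L}

theorem isSMulRegular_tensor_quotient_smul_top {I : Ideal A} [I.IsMaximal] {b : B}
    (hb : IsSMulRegular (G ⊗[A] (A ⧸ I)) b) [Module.Finite A L] :
    IsSMulRegular (G ⊗[A] (L ⧸ I • (⊤ : Submodule A L))) b := by
  let := Ideal.Quotient.field I
  have : Module.Finite (A ⧸ I) (L ⧸ I • (⊤ : Submodule A L)) :=
    Module.Finite.of_restrictScalars_finite A _ _
  let e₀ := (Module.finBasis (A ⧸ I) (L ⧸ I • (⊤ : Submodule A L))).equivFun.restrictScalars A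
  let e := (AlgebraTensorModule.congr (LinearEquiv.refl B G) e₀).trans
    (piRight A B G fun _ => A ⧸ I)
  rw [e.isSMulRegular_congr]
  exact IsSMulRegular.pi fun _ => hb

theorem lTensor_injective_of_flat [Module.Flat A G] (U : Submodule A L) :
    Function.Injective (AlgebraTensorModule.lTensor B G U.subtype) := by
  rw [AlgebraTensorModule.coe_lTensor]
  exact Module.Flat.lTensor_preserves_injective_linearMap _ U.injective_subtype

theorem exists_lTensor_eq_of_smul_eq_zero {U : Submodule A L} {b : B}
    (hb : IsSMulRegular (G ⊗[A] (L ⧸ U)) b) {t : G ⊗[A] L}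
    {s : G ⊗[A] U} (ht : b • t = AlgebraTensorModule.lTensor B G U.subtype s) :
    ∃ s', AlgebraTensorModule.lTensor B G U.subtype s' = t := by
  have hex := lTensor_exact G (LinearMap.exact_subtype_mkQ U) (Submodule.mkQ_surjective _)
  rw [AlgebraTensorModule.coe_lTensor] at ht ⊢
  refine (hex t).mp ?_
  rw [← AlgebraTensorModule.coe_lTensor (A := B)]
  apply hb
  change b • _ = b • (0 : G ⊗[A] (L ⧸ U))
  rw [← map_smul, smul_zero, ht, AlgebraTensorModule.coe_lTensor]
  exact hex.apply_apply_eq_zero s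

theorem mem_pow_smul_top_of_smul_eq_zero [IsNoetherianRing A] [Module.Flat A G] {I : Ideal A}
    [I.IsMaximal] {b : B} (hb : IsSMulRegular (G ⊗[A] (A ⧸ I)) b) (n : ℕ) {L : Type*}
    [AddCommGroup L] [Module A L] [Module.Finite A L] (t : G ⊗[A] L) (ht : b • t = 0) :
    t ∈ (I.map (algebraMap A B)) ^ n • (⊤ : Submodule B (G ⊗[A] L)) := by
  induction n generalizing L with
  | zero => simp
  | succ n ih =>
    obtain ⟨s, rfl⟩ := exists_lTensor_eq_of_smul_eq_zero (s := 0)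
      (isSMulRegular_tensor_quotient_smul_top hb) (by rw [ht, map_zero])
    have hs : b • s = 0 := by
      apply lTensor_injective_of_flat (B := B)
      rw [map_smul, ht, map_zero]
    have h1 := Submodule.mem_map_of_mem
      (f := AlgebraTensorModule.lTensor B G (I • (⊤ : Submodule A L)).subtype) (ih s hs)
    rw [Submodule.map_smul''] at h1
    rw [pow_succ, mul_smul]
    refine Submodule.smul_mono le_rfl ?_ h1
    rintro _ ⟨u, -, rfl⟩
    induction u with
    | zero => simp
    | add u v hu hv =>
      rw [map_add]
      exact Submodule.add_mem _ hu hv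
    | tmul g l =>
      obtain ⟨l, hl⟩ := l
      change g ⊗ₜ[A] l ∈ _
      refine Submodule.smul_induction_on hl (fun a ha l _ => ?_) fun l l' hl hl' => ?_
      · rw [← smul_tmul, ← algebraMap_smul B a g, ← smul_tmul']
        exact Submodule.smul_mem_smul (Ideal.mem_map_of_mem _ ha) trivial
      · rw [tmul_add]
        exact Submodule.add_mem _ hl hl'

theorem isSMulRegular_tensor [IsNoetherianRing A] [IsLocalRing A] [IsNoetherianRing B]
    [IsLocalRing B] [IsLocalHom (algebraMap A B)] [Module.Flat A G] [Module.Finite B G] {b : B}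
    (hb : IsSMulRegular (G ⊗[A] (A ⧸ maximalIdeal A)) b) [Module.Finite A L] :
    IsSMulRegular (G ⊗[A] L) b := by
  have : Module.Finite B (G ⊗[A] L) := finite_tensorProduct G L
  refine isSMulRegular_iff_right_eq_zero_of_smul.mpr fun t ht => ?_
  have hne : (maximalIdeal A).map (algebraMap A B) ≠ ⊤ := fun h =>
    (maximalIdeal.isMaximal B).ne_top (top_le_iff.mp (h ▸ map_maximalIdeal_le _))
  rw [← Submodule.mem_bot B, ← Ideal.iInf_pow_smul_eq_bot_of_isLocalRing _ hne,
    Submodule.mem_iInf]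
  exact fun n => mem_pow_smul_top_of_smul_eq_zero hb n t ht

theorem flat_of_ker_eq_smul_top [IsNoetherianRing A] [IsLocalRing A] [IsNoetherianRing B]
    [IsLocalRing B] [IsLocalHom (algebraMap A B)] [Module.Flat A G] [Module.Finite B G] {b : B}
    (hb : IsSMulRegular (G ⊗[A] (A ⧸ maximalIdeal A)) b)
    {Q : Type*} [AddCommGroup Q] [Module A Q] [Module B Q]
    [IsScalarTower A B Q] {π : G →ₗ[B] Q} (hπ : Function.Surjective π)
    (hk : LinearMap.ker π = b • (⊤ : Submodule B G)) :
    Module.Flat A Q := by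
  refine Module.Flat.iff_lTensor_injective'.mpr fun I => ?_
  rw [← AlgebraTensorModule.coe_lTensor (A := B), injective_iff_map_eq_zero]
  intro q hq
  obtain ⟨t, rfl⟩ := rTensor_surjective I hπ q
  have hcomm : (AlgebraTensorModule.lTensor B Q I.subtype).comp
      (AlgebraTensorModule.rTensor A I π) =
      (AlgebraTensorModule.rTensor A A π).comp (AlgebraTensorModule.lTensor B G I.subtype) := by
    ext
    rfl
  have hq' := (LinearMap.congr_fun hcomm t).symm.trans hq
  obtain ⟨s, hs⟩ := (mem_ker_rTensor_iff A hπ hk _).mp hq'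
  obtain ⟨s', rfl⟩ := exists_lTensor_eq_of_smul_eq_zero (U := I)
    (isSMulRegular_tensor (L := A ⧸ I) hb) hs
  rw [← map_smul] at hs
  exact (mem_ker_rTensor_iff I hπ hk _).mpr ⟨s', lTensor_injective_of_flat I hs⟩

theorem isWeaklyRegular_tensor [IsNoetherianRing A] [IsLocalRing A] [IsNoetherianRing B]
    [IsLocalRing B] [IsLocalHom (algebraMap A B)] [Module.Flat A G] [Module.Finite B G]
    {bs : List B} (hb : IsWeaklyRegular (G ⊗[A] (A ⧸ maximalIdeal A)) bs) [Module.Finite A L] :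
    IsWeaklyRegular (G ⊗[A] L) bs := by
  induction bs generalizing G with
  | nil => exact IsWeaklyRegular.nil _ _
  | cons b bs ih =>
    rw [isWeaklyRegular_cons_iff] at hb ⊢
    refine ⟨isSMulRegular_tensor hb.1, ?_⟩
    have hπ := Submodule.mkQ_surjective (b • (⊤ : Submodule B G))
    have hk := Submodule.ker_mkQ (b • (⊤ : Submodule B G))
    have := flat_of_ker_eq_smul_top hb.1 hπ hk
    rw [(quotSMulTopTensorEquiv L hπ hk).isWeaklyRegular_congr]
    exact ih ((quotSMulTopTensorEquiv _ hπ hk).isWeaklyRegular_congr bs |>.mp hb.2)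

end Tensor

section LocalFlat

open TensorProduct

theorem HasRegularSeq.congr {A : Type*} [CommRing A] [IsLocalRing A] {N N' : Type*}
    [AddCommGroup N] [Module A N] [AddCommGroup N'] [Module A N'] (e : N ≃ₗ[A] N') {n : ℕ}
    (h : HasRegularSeq A N n) : HasRegularSeq A N' n := by
  obtain ⟨rs, mem, reg, len⟩ := h
  exact ⟨rs, mem, (e.isRegular_congr rs).mp reg, len⟩

variable {A B : Type} [CommRing A] [CommRing B] [Algebra A B]

theorem isSMulRegular_baseChange [Module.Flat A B] {N : Type} [AddCommGroup N] [Module A N]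
    {x : A} (hx : IsSMulRegular N x) : IsSMulRegular (B ⊗[A] N) (algebraMap A B x) := by
  intro s t hst
  have h : IsSMulRegular (B ⊗[A] N) x := hx.lTensor B
  apply h
  simpa only [algebraMap_smul] using hst

variable [IsNoetherianRing A] [IsLocalRing A] [IsNoetherianRing B] [IsLocalRing B]
  [IsLocalHom (algebraMap A B)] [Module.Flat A B]

theorem isWeaklyRegular_append_tensor {N : Type} [AddCommGroup N] [Module A N]
    [Module.Finite A N] {as : List A} (ha : IsWeaklyRegular N as) {bs : List B}
    (hb : IsWeaklyRegular (B ⊗[A] (A ⧸ maximalIdeal A)) bs) :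
    IsWeaklyRegular (B ⊗[A] N) (as.map (algebraMap A B) ++ bs) := by
  induction as generalizing N with
  | nil => exact isWeaklyRegular_tensor hb
  | cons x as ih =>
    rw [isWeaklyRegular_cons_iff] at ha
    rw [List.map_cons, List.cons_append, isWeaklyRegular_cons_iff]
    refine ⟨isSMulRegular_baseChange ha.1, ?_⟩
    rw [(quotSMulTopTensorEquiv' B N x).isWeaklyRegular_congr]
    exact ih ha.2

theorem HasRegularSeq.tensor {N : Type} [AddCommGroup N] [Module A N]
    [Module.Finite A N] {d e : ℕ} (ha : HasRegularSeq A N d)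
    (hb : HasRegularSeq B (B ⊗[A] (A ⧸ maximalIdeal A)) e) [Nontrivial (B ⊗[A] N)] :
    HasRegularSeq B (B ⊗[A] N) (d + e) := by
  obtain ⟨as, hma, hra, rfl⟩ := ha
  obtain ⟨bs, hmb, hrb, rfl⟩ := hb
  have hmem : ∀ r ∈ as.map (algebraMap A B) ++ bs, r ∈ maximalIdeal B := by
    intro r hr
    rcases List.mem_append.mp hr with hr | hr
    · obtain ⟨a, ha, rfl⟩ := List.mem_map.mp hr
      exact map_maximalIdeal_le (algebraMap A B) (Ideal.mem_map_of_mem _ (hma a ha))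
    · exact hmb r hr
  refine ⟨as.map (algebraMap A B) ++ bs, hmem, ?_, by simp⟩
  exact IsRegular.of_isWeaklyRegular_of_mem_maximalIdeal _ hmem
    (isWeaklyRegular_append_tensor hra.toIsWeaklyRegular hrb.toIsWeaklyRegular)

theorem HasRegularSeq.of_tensor {d e : ℕ} {N : Type} [AddCommGroup N] [Module A N]
    [Module.Finite A N] (hd : Module.supportDim A N = d)
    (he : Module.supportDim B (B ⊗[A] (A ⧸ maximalIdeal A)) = e)
    (h : HasRegularSeq B (B ⊗[A] N) (d + e)) : HasRegularSeq A N d := by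
  have hN : Nontrivial N := by
    by_contra hN
    rw [not_nontrivial_iff_subsingleton] at hN
    rw [Module.supportDim_eq_bot_of_subsingleton] at hd
    exact absurd hd (by simp)
  induction d generalizing N with
  | zero => exact ⟨[], by simp, IsRegular.nil A N, rfl⟩
  | succ d ih =>
    by_cases hx : ∃ x ∈ maximalIdeal A, IsSMulRegular N x
    · obtain ⟨x, hxm, hx⟩ := hx
      have hntr := nontrivial_quotSMulTop_of_mem_maximalIdeal N hxm
      have hdim := Module.supportDim_quotSMulTop_succ_eq_supportDim hx hxm
      obtain ⟨d', hd'⟩ := exists_nat_eq_supportDim A (QuotSMulTop x N)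
      have hdd : d' = d := by
        rw [hd, hd'] at hdim
        have : d' + 1 = d + 1 := by exact_mod_cast hdim
        omega
      subst hdd
      rw [add_right_comm] at h
      have h' := (h.quotSMulTop
        (map_maximalIdeal_le (algebraMap A B) (Ideal.mem_map_of_mem _ hxm))
        (isSMulRegular_baseChange hx)).congr (quotSMulTopTensorEquiv' B N x)
      obtain ⟨rs, mem, reg, len⟩ := ih hd' h' hntr
      refine ⟨x :: rs, ?_, (isRegular_cons_iff N x rs).mpr ⟨hx, reg⟩, by simp [len]⟩
      simpa using ⟨hxm, mem⟩
    · exfalso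
      have hns : ¬ Subsingleton ((A ⧸ maximalIdeal A) →ₗ[A] N) := by
        rw [IsSMulRegular.subsingleton_linearMap_iff]
        simpa [Ideal.annihilator_quotient] using hx
      rw [not_subsingleton_iff_nontrivial] at hns
      obtain ⟨f, hf⟩ := exists_ne (0 : (A ⧸ maximalIdeal A) →ₗ[A] N)
      have hsimple : IsSimpleModule A (A ⧸ maximalIdeal A) :=
        (isSimpleModule_iff_isCoatom).mpr (maximalIdeal.isMaximal A).out
      have hinj := f.injective_of_ne_zero hf
      let g := AlgebraTensorModule.lTensor B B f
      have hg : Function.Injective g := by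
        rw [AlgebraTensorModule.coe_lTensor]
        exact Module.Flat.lTensor_preserves_injective_linearMap f hinj
      have hdimr : Module.supportDim B (B ⊗[A] (A ⧸ maximalIdeal A)) =
          Module.supportDim B (LinearMap.range g) :=
        Module.supportDim_eq_of_equiv (LinearEquiv.ofInjective g hg)
      have hfin : Module.Finite B (B ⊗[A] N) := inferInstance
      have hle := h.le_supportDim_submodule (LinearMap.range g) (by
        intro h0
        have hsub : Subsingleton (LinearMap.range g) := by
          rw [h0]
          infer_instance
        rw [he, Module.supportDim_eq_bot_of_subsingleton B (LinearMap.range g)] at hdimr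
        exact absurd hdimr (by simp))
      rw [← hdimr, he] at hle
      have : d + 1 + e ≤ e := by exact_mod_cast hle
      omega

end LocalFlat

section Dimension

open TensorProduct

theorem map_maximalIdeal_of_surjective {A A' : Type*} [CommRing A] [CommRing A'] [IsLocalRing A]
    [IsLocalRing A'] {f : A →+* A'} (hf : Function.Surjective f) :
    (maximalIdeal A).map f = maximalIdeal A' := by
  have := hf.isLocalHom
  refine le_antisymm (map_maximalIdeal_le f) fun x hx => ?_
  obtain ⟨y, rfl⟩ := hf x
  refine Ideal.mem_map_of_mem f ?_
  rw [mem_maximalIdeal, mem_nonunits_iff] at hx ⊢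
  exact fun h => hx (h.map f)

variable {A B : Type*} [CommRing A] [CommRing B] [Algebra A B]

/-- The annihilator of a finite module commutes with flat base change. -/
theorem annihilator_tensor_of_flat [Module.Flat A B] (N : Type*) [AddCommGroup N] [Module A N]
    [Module.Finite A N] : Module.annihilator B (B ⊗[A] N) =
      (Module.annihilator A N).map (algebraMap A B) := by
  refine le_antisymm (fun b hb => ?_) ?_
  · obtain ⟨n, s, hs⟩ := Module.Finite.exists_fin (R := A) (M := N)
    let f : A →ₗ[A] (Fin n → N) := LinearMap.pi fun i => LinearMap.toSpanSingleton A N (s i)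
    have hker : Module.annihilator A N = LinearMap.ker f := by
      ext a
      rw [Module.mem_annihilator, LinearMap.mem_ker]
      refine ⟨fun h => funext fun i => h _, fun h m => ?_⟩
      have hm : m ∈ Submodule.span A (Set.range s) := hs ▸ Submodule.mem_top
      induction hm using Submodule.span_induction with
      | mem x hx =>
        obtain ⟨i, rfl⟩ := hx
        exact congrFun h i
      | zero => simp
      | add x y _ _ hx hy => rw [smul_add, hx, hy, add_zero]
      | smul c x _ hx => rw [smul_comm, hx, smul_zero]
    let g : (A ⧸ Module.annihilator A N) →ₗ[A] (Fin n → N) :=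
      Submodule.liftQ _ f hker.le
    have hg : Function.Injective g := by
      rw [← LinearMap.ker_eq_bot]
      exact Submodule.ker_liftQ_eq_bot _ _ _ hker.ge
    have hg' := Module.Flat.lTensor_preserves_injective_linearMap (M := B) g hg
    let φ := (piRight A B B fun _ : Fin n => N).toLinearMap.comp
      (AlgebraTensorModule.lTensor B B g)
    have hφ : Function.Injective φ :=
      (piRight A B B fun _ : Fin n => N).injective.comp hg'
    have h0 : b • ((1 : B) ⊗ₜ[A] (1 : A ⧸ Module.annihilator A N)) = 0 := by
      apply hφ
      rw [map_smul, map_zero]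
      exact funext fun i => Module.mem_annihilator.mp hb _
    have h1 := congrArg
      (Algebra.TensorProduct.quotIdealMapEquivTensorQuot B (Module.annihilator A N)).symm h0
    rw [map_zero, map_smul] at h1
    rw [← Algebra.TensorProduct.one_def, map_one] at h1
    rw [← Ideal.Quotient.eq_zero_iff_mem, ← h1, Algebra.smul_def, mul_one]
    rfl
  · rw [Ideal.map_le_iff_le_comap]
    intro a ha
    rw [Ideal.mem_comap, Module.mem_annihilator]
    intro t
    induction t with
    | zero => simp
    | add s t hs ht => rw [smul_add, hs, ht, add_zero]
    | tmul b m =>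
      rw [algebraMap_smul, smul_tmul', smul_tmul, Module.mem_annihilator.mp ha, tmul_zero]

variable [IsLocalRing A]

theorem supportDim_tensor_quotient : Module.supportDim B (B ⊗[A] (A ⧸ maximalIdeal A)) =
    ringKrullDim (B ⧸ (maximalIdeal A).map (algebraMap A B)) := by
  rw [← Module.supportDim_quotient_eq_ringKrullDim]
  exact (Module.supportDim_eq_of_equiv
    (Algebra.TensorProduct.quotIdealMapEquivTensorQuot B (maximalIdeal A)).toLinearEquiv).symm

variable [IsLocalRing B] [IsLocalHom (algebraMap A B)]

theorem isLocalRing_quotient_map : IsLocalRing (B ⧸ (maximalIdeal A).map (algebraMap A B)) := by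
  have : Nontrivial (B ⧸ (maximalIdeal A).map (algebraMap A B)) :=
    Ideal.Quotient.nontrivial_iff.mpr fun h =>
      (maximalIdeal.isMaximal B).ne_top (top_le_iff.mp (h ▸ map_maximalIdeal_le _))
  exact IsLocalRing.of_surjective' _ Ideal.Quotient.mk_surjective

variable [IsNoetherianRing A] [IsNoetherianRing B] [Module.Flat A B]

variable (A B) in
theorem ringKrullDim_eq_add_of_flat : ringKrullDim B =
    ringKrullDim A + ringKrullDim (B ⧸ (maximalIdeal A).map (algebraMap A B)) := by
  have := isLocalRing_quotient_map (A := A) (B := B)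
  have h := Ideal.height_eq_height_add_of_liesOver_of_hasGoingDown (maximalIdeal A)
    (maximalIdeal B)
  rw [map_maximalIdeal_of_surjective Ideal.Quotient.mk_surjective] at h
  rw [← maximalIdeal_height_eq_ringKrullDim, ← maximalIdeal_height_eq_ringKrullDim,
    ← maximalIdeal_height_eq_ringKrullDim, h]
  rfl

theorem supportDim_tensor_of_flat (N : Type*) [AddCommGroup N] [Module A N] [Module.Finite A N]
    [Nontrivial N] : Module.supportDim B (B ⊗[A] N) =
      Module.supportDim A N +
        ringKrullDim (B ⧸ (maximalIdeal A).map (algebraMap A B)) := by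
  rw [Module.supportDim_eq_ringKrullDim_quotient_annihilator,
    Module.supportDim_eq_ringKrullDim_quotient_annihilator, annihilator_tensor_of_flat]
  have hI : Module.annihilator A N ≠ ⊤ := by
    rw [Ne, Module.annihilator_eq_top_iff]
    exact not_subsingleton N
  generalize Module.annihilator A N = I at hI
  have hIm : I ≤ maximalIdeal A := le_maximalIdeal hI
  have hIm' : I.map (algebraMap A B) ≤ (maximalIdeal A).map (algebraMap A B) :=
    Ideal.map_mono hIm
  have : Nontrivial (A ⧸ I) := Ideal.Quotient.nontrivial_iff.mpr hI
  have : IsLocalRing (A ⧸ I) := IsLocalRing.of_surjective' _ Ideal.Quotient.mk_surjective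
  have : Nontrivial (B ⧸ I.map (algebraMap A B)) :=
    Ideal.Quotient.nontrivial_iff.mpr fun h =>
      (maximalIdeal.isMaximal B).ne_top
        (top_le_iff.mp ((h ▸ hIm').trans (map_maximalIdeal_le _)))
  have : IsLocalRing (B ⧸ I.map (algebraMap A B)) :=
    IsLocalRing.of_surjective' _ Ideal.Quotient.mk_surjective
  have hlocB : IsLocalHom (Ideal.Quotient.mk (I.map (algebraMap A B))) :=
    Ideal.Quotient.mk_surjective.isLocalHom
  have : IsLocalHom (algebraMap (A ⧸ I) (B ⧸ I.map (algebraMap A B))) := by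
    refine ⟨fun a ha => ?_⟩
    obtain ⟨a, rfl⟩ := Ideal.Quotient.mk_surjective a
    have h1 : IsUnit (Ideal.Quotient.mk (I.map (algebraMap A B)) (algebraMap A B a)) := ha
    exact ((h1.of_map _ _).of_map (algebraMap A B) a).map _
  have : Module.Flat (A ⧸ I) (B ⧸ I.map (algebraMap A B)) :=
    Module.Flat.of_linearEquiv
      (Algebra.TensorProduct.quotIdealMapEquivQuotTensor B I).toLinearEquiv
  rw [ringKrullDim_eq_add_of_flat (A ⧸ I) (B ⧸ I.map (algebraMap A B))]
  congr 1
  refine ringKrullDim_eq_of_ringEquiv ((Ideal.quotEquivOfEq ?_).trans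
    (DoubleQuot.quotQuotEquivQuotOfLE hIm'))
  rw [← map_maximalIdeal_of_surjective (f := Ideal.Quotient.mk I) Ideal.Quotient.mk_surjective,
    Ideal.map_map, Ideal.map_map]
  rfl

end Dimension

section Descent

open TensorProduct

theorem HasRegularSeq.of_surjective_algebraMap {B F : Type*} [CommRing B] [CommRing F]
    [IsLocalRing B] [IsLocalRing F] [Algebra B F] (hf : Function.Surjective (algebraMap B F))
    {n : ℕ} (h : HasRegularSeq F F n) : HasRegularSeq B F n := by
  obtain ⟨rs, mem, reg, rfl⟩ := h
  have hloc := hf.isLocalHom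
  obtain ⟨bs, rfl⟩ := (List.map_surjective_iff.mpr hf) rs
  have hmem : ∀ r ∈ bs, r ∈ maximalIdeal B := by
    intro r hr
    have := mem _ (List.mem_map_of_mem hr)
    rw [mem_maximalIdeal, mem_nonunits_iff] at this ⊢
    exact fun h => this (h.map _)
  have : Module.Finite B F := Module.Finite.of_surjective (Algebra.linearMap B F) hf
  exact ⟨bs, hmem, IsRegular.of_isWeaklyRegular_of_mem_maximalIdeal _ hmem
    ((isWeaklyRegular_map_algebraMap_iff F F bs).mp reg.toIsWeaklyRegular), by simp⟩

variable {A B : Type} [CommRing A] [CommRing B] [Algebra A B]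
  [IsNoetherianRing A] [IsLocalRing A] [IsNoetherianRing B] [IsLocalRing B]
  [IsLocalHom (algebraMap A B)] [Module.Flat A B]

/-- Cohen–Macaulayness ascends and descends along a flat local homomorphism with
Cohen–Macaulay closed fibre. -/
theorem isCMLocalMod_tensor_iff {F : Type} [CommRing F]
    (σ : B ⧸ (maximalIdeal A).map (algebraMap A B) ≃+* F) (hF : IsCMLocalRing F)
    (N : Type) [AddCommGroup N] [Module A N] [Module.Finite A N] [Nontrivial N] :
    IsCMLocalMod A N ↔ IsCMLocalMod B (B ⊗[A] N) := by
  have := hF.1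
  let := (σ.toRingHom.comp (Ideal.Quotient.mk _)).toAlgebra (R := B) (S := F)
  have hsurj : Function.Surjective (algebraMap B F) :=
    σ.surjective.comp Ideal.Quotient.mk_surjective
  have : IsNoetherianRing F := isNoetherianRing_of_surjective B F (algebraMap B F) hsurj
  obtain ⟨d, hd⟩ := exists_nat_eq_supportDim A N
  obtain ⟨e, he⟩ := exists_nat_eq_supportDim F F
  rw [Module.supportDim_self_eq_ringKrullDim] at he
  have he' := (ringKrullDim_eq_of_ringEquiv σ).trans he
  have hde : Module.supportDim B (B ⊗[A] N) = ((d + e : ℕ) : WithBot ℕ∞) := by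
    rw [supportDim_tensor_of_flat, hd, he']
    rfl
  have hntr : Nontrivial (B ⊗[A] N) := by
    rw [← Module.supportDim_ne_bot_iff_nontrivial B, hde]
    simp
  let τ : F ≃ₗ[B] B ⊗[A] (A ⧸ maximalIdeal A) :=
    { σ.symm with
      map_smul' := fun b f => by
        change σ.symm (b • f) = b • σ.symm f
        rw [Algebra.smul_def, map_mul, Algebra.smul_def]
        congr 1
        exact σ.symm_apply_apply _ } ≪≫ₗ
      (Algebra.TensorProduct.quotIdealMapEquivTensorQuot B (maximalIdeal A)).toLinearEquiv
  have hreg : HasRegularSeq B (B ⊗[A] (A ⧸ maximalIdeal A)) e :=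
    ((hF.hasRegularSeq he).of_surjective_algebraMap hsurj).congr τ
  rw [isCMLocalMod_iff hd, isCMLocalMod_iff hde]
  exact ⟨fun h => h.tensor hreg, fun h => h.of_tensor hd (supportDim_tensor_quotient.trans he')⟩

end Descent

section Localization

open scoped TensorProduct

theorem IsCMLocalMod.congr {A N N' : Type} [CommRing A] [IsLocalRing A] [AddCommGroup N]
    [Module A N] [AddCommGroup N'] [Module A N'] (e : N ≃ₗ[A] N') (h : IsCMLocalMod A N) :
    IsCMLocalMod A N' := by
  simpa only [IsCMLocalMod, depthOn, dimMod, e.annihilator_eq, e.isRegular_congr] using h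

theorem isCMLocalMod_congr {A N N' : Type} [CommRing A] [IsLocalRing A] [AddCommGroup N]
    [Module A N] [AddCommGroup N'] [Module A N'] (e : N ≃ₗ[A] N') :
    IsCMLocalMod A N ↔ IsCMLocalMod A N' :=
  ⟨.congr e, .congr e.symm⟩

variable {R S : Type} [CommRing R] [CommRing S] [Algebra R S]

theorem exists_prime_fiber (p : Ideal R) [p.IsPrime] (P : Ideal S) [P.IsPrime] [P.LiesOver p] :
    ∃ (q : Ideal (p.Fiber S)) (_ : q.IsPrime),
      P = q.comap (Algebra.TensorProduct.includeRight : S →ₐ[R] p.Fiber S) := by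
  have h := PrimeSpectrum.coe_primesOverOrderIsoFiber_symm_apply p
    (PrimeSpectrum.primesOverOrderIsoFiber R S p ⟨P, inferInstance, inferInstance⟩)
  rw [OrderIso.symm_apply_apply] at h
  exact ⟨_, PrimeSpectrum.isPrime _, h⟩

/-- The closed fibre of `R_p → S_P` is a localization of the fibre of `S` over `p`. -/
theorem exists_equiv_localization_fiber (p : Ideal R) [p.IsPrime] (P : Ideal S) [P.IsPrime]
    [P.LiesOver p] [Algebra (Localization.AtPrime p) (Localization.AtPrime P)]
    [Localization.AtPrime.IsLiesOverAlgebra p P] :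
    ∃ (q : Ideal (p.Fiber S)) (_ : q.IsPrime),
      Nonempty (Localization.AtPrime P ⧸ (maximalIdeal (Localization.AtPrime p)).map
        (algebraMap _ (Localization.AtPrime P)) ≃+* Localization.AtPrime q) := by
  obtain ⟨q, hq, rfl⟩ := exists_prime_fiber p P
  refine ⟨q, hq, ⟨(Ideal.quotEquivOfEq ?_).trans
    (Ideal.Fiber.localizationAlgEquivQuotient p q).symm.toRingEquiv⟩⟩
  rw [← Localization.AtPrime.map_eq_maximalIdeal, Ideal.map_map, ← IsScalarTower.algebraMap_eq]

theorem IsCMRing.exists_localization_equiv {T T' : Type} [CommRing T] [CommRing T']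
    (h : IsCMRing T') (e : T ≃+* T') (q : Ideal T) [q.IsPrime] :
    ∃ (F : Type) (_ : CommRing F), IsCMLocalRing F ∧ Nonempty (Localization.AtPrime q ≃+* F) := by
  refine ⟨_, _, h (q.comap e.symm), ⟨IsLocalization.ringEquivOfRingEquiv _ _ e
    (M := q.primeCompl) (T := (q.comap e.symm).primeCompl) ?_⟩⟩
  ext x
  refine ⟨?_, fun hx => ⟨e.symm x, hx, e.apply_symm_apply x⟩⟩
  rintro ⟨y, hy, rfl⟩ hx
  exact hy (by simpa using hx)

/-- Localization at a prime commutes with base change. -/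
def localizedModuleTensorEquiv (p : Ideal R) [p.IsPrime] (P : Ideal S) [P.IsPrime]
    [P.LiesOver p] [Algebra (Localization.AtPrime p) (Localization.AtPrime P)]
    [Localization.AtPrime.IsLiesOverAlgebra p P] (M : Type) [AddCommGroup M] [Module R M] :
    LocalizedModule P.primeCompl (S ⊗[R] M) ≃ₗ[Localization.AtPrime P]
      Localization.AtPrime P ⊗[Localization.AtPrime p] LocalizedModule p.primeCompl M :=
  LocalizedModule.equivTensorProduct P.primeCompl (S ⊗[R] M) ≪≫ₗ
    TensorProduct.AlgebraTensorModule.cancelBaseChange R S (Localization.AtPrime P)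
      (Localization.AtPrime P) M ≪≫ₗ
    (TensorProduct.AlgebraTensorModule.cancelBaseChange R (Localization.AtPrime p)
      (Localization.AtPrime P) (Localization.AtPrime P) M).symm ≪≫ₗ
    TensorProduct.AlgebraTensorModule.congr (.refl _ _)
      (LocalizedModule.equivTensorProduct p.primeCompl M).symm

/-- Cohen–Macaulayness of localizations ascends and descends along a flat homomorphism with
Cohen–Macaulay fibres. -/
theorem isCMLocalMod_localizedModule_iff [IsNoetherianRing R] [IsNoetherianRing S]
    [Module.Flat R S] (p : Ideal R) [p.IsPrime] (P : Ideal S) [P.IsPrime] [P.LiesOver p]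
    (h : IsCMRing (S ⊗[R] (Localization.AtPrime p ⧸ maximalIdeal (Localization.AtPrime p))))
    {M M' : Type} [AddCommGroup M] [Module R M] [Module.Finite R M] [AddCommGroup M'] [Module S M']
    (e : S ⊗[R] M ≃ₗ[S] M') (hP : P ∈ supp S M') :
    IsCMLocalMod (Localization.AtPrime p) (LocalizedModule p.primeCompl M) ↔
      IsCMLocalMod (Localization.AtPrime P) (LocalizedModule P.primeCompl M') := by
  let := Localization.AtPrime.algebraOfLiesOver p P
  have : Module.Finite S M' := Module.Finite.equiv e
  let ε := IsLocalizedModule.mapEquiv P.primeCompl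
    (LocalizedModule.mkLinearMap P.primeCompl (S ⊗[R] M))
    (LocalizedModule.mkLinearMap P.primeCompl M') (Localization.AtPrime P) e
  let δ := ε.symm ≪≫ₗ localizedModuleTensorEquiv p P M
  have : Nontrivial (LocalizedModule P.primeCompl M') := by
    have : (⟨P, inferInstance⟩ : PrimeSpectrum S) ∈ Module.support S M' :=
      Module.mem_support_iff_of_finite.mpr hP.2
    exact this
  have : Nontrivial (LocalizedModule p.primeCompl M) := by
    by_contra hN
    rw [not_nontrivial_iff_subsingleton] at hN
    exact not_subsingleton _ δ.toEquiv.subsingleton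
  have : Module.Finite (Localization.AtPrime p) (LocalizedModule p.primeCompl M) :=
    inferInstance
  have : IsLocalHom (algebraMap (Localization.AtPrime p) (Localization.AtPrime P)) :=
    Localization.isLocalHom_localRingHom p P _ _
  obtain ⟨q, _, ⟨σ⟩⟩ := exists_equiv_localization_fiber p P
  obtain ⟨F, _, hF, ⟨τ⟩⟩ :=
    h.exists_localization_equiv (Algebra.TensorProduct.comm R p.ResidueField S).toRingEquiv q
  have : IsNoetherianRing (Localization.AtPrime p) :=
    IsLocalization.isNoetherianRing p.primeCompl _ inferInstance
  have : IsNoetherianRing (Localization.AtPrime P) :=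
    IsLocalization.isNoetherianRing P.primeCompl _ inferInstance
  rw [isCMLocalMod_tensor_iff (σ.trans τ) hF]
  exact isCMLocalMod_congr δ.symm

end Localization

end Paper

/-- If all formal fibres of the Noetherian local ring `R` are Cohen–Macaulay, `P` is a
prime of the completion in the support of the completed module, and `p = P ∩ R`, then
`M_p` is Cohen–Macaulay iff `(M^)_P` is Cohen–Macaulay. -/
theorem localization_CM_iff_completion_localization_CM (R : Type) [CommRing R]
    [IsNoetherianRing R] [IsLocalRing R]
    (M : Type) [AddCommGroup M] [Module R M] [Module.Finite R M]
    (hff : ∀ (p : Ideal R) [p.IsPrime],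
      Paper.IsCMRing (TensorProduct R (AdicCompletion (IsLocalRing.maximalIdeal R) R)
        (Localization.AtPrime p ⧸ IsLocalRing.maximalIdeal (Localization.AtPrime p))))
    (P : Ideal (AdicCompletion (IsLocalRing.maximalIdeal R) R)) [P.IsPrime]
    (hP : P ∈ Paper.supp (AdicCompletion (IsLocalRing.maximalIdeal R) R)
        (AdicCompletion (IsLocalRing.maximalIdeal R) M)) :
    Paper.IsCMLocalMod
        (Localization.AtPrime
          (P.comap (algebraMap R (AdicCompletion (IsLocalRing.maximalIdeal R) R))))
        (LocalizedModule
          (P.comap (algebraMap R (AdicCompletion (IsLocalRing.maximalIdeal R) R))).primeCompl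
          M) ↔
      Paper.IsCMLocalMod (Localization.AtPrime P)
        (LocalizedModule P.primeCompl (AdicCompletion (IsLocalRing.maximalIdeal R) M)) := by
  have := AdicCompletion.isNoetherianRing (IsLocalRing.maximalIdeal R)
  exact Paper.isCMLocalMod_localizedModule_iff _ P (hff _)
    (AdicCompletion.ofTensorProductEquivOfFiniteNoetherian _ M) hP
end
end
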